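/- arXiv:2210.02295 — 3 statements merged into one kernel-verified Lean document; each statement's English description precedes it below -/
import Mathlib

section
/- Let μ ∈ (0,1), let U be a neighborhood of the origin in ℝ², and let F : U → ℝ² be a C² map with F(0,0) = (0,0), DF(0,0) = diag(μ, μ^{-1}), and both components of F having vanishing mixed second partial derivative ∂²F/∂x∂y at (0,0). Let ξ, u : U → ℝ be C² functions and set ξ' = ξ − u + u ∘ F. Then ∂²ξ'/∂x∂y(0,0) = ∂²ξ/∂x∂y(0,0). -/
open scoped Topology
open Set

noncomputable section

namespace Paper

/-- The mixed partial derivative `∂²f/∂x∂y` at the origin of a function on `ℝ²`. -/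
def mixedPartial (f : ℝ × ℝ → ℝ) : ℝ :=
  deriv (fun a : ℝ => deriv (fun b : ℝ => f (a, b)) 0) 0

/-- The mixed partial derivative at the origin of each component of a planar map. -/
def mixedPartialFst (F : ℝ × ℝ → ℝ × ℝ) : ℝ := mixedPartial fun z => (F z).1

def mixedPartialSnd (F : ℝ × ℝ → ℝ × ℝ) : ℝ := mixedPartial fun z => (F z).2

/-- A `C²` map has its iterated partial derivative at the origin given by the second
Fréchet derivative. -/
theorem hasDerivAt_partial_snd {V : Type*} [NormedAddCommGroup V] [NormedSpace ℝ V]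
    {f : ℝ × ℝ → V} (hf : ContDiffAt ℝ 2 f (0, 0)) :
    HasDerivAt (fun a : ℝ => fderiv ℝ f (a, 0) (0, 1))
      (fderiv ℝ (fderiv ℝ f) (0, 0) (1, 0) (0, 1)) 0 := by
  have hd : HasFDerivAt (fderiv ℝ f) (fderiv ℝ (fderiv ℝ f) (0, 0)) ((0 : ℝ), (0 : ℝ)) :=
    ((hf.fderiv_right (m := 1) (by norm_num)).differentiableAt (by norm_num)).hasFDerivAt
  have hline : HasDerivAt (fun a : ℝ => (a, (0 : ℝ))) (1, 0) 0 :=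
    (hasDerivAt_id (0 : ℝ)).prodMk (hasDerivAt_const _ _)
  have h := hd.comp_hasDerivAt (f := fun a : ℝ => (a, (0 : ℝ))) (0 : ℝ) hline
  simpa using h.clm_apply (hasDerivAt_const (0 : ℝ) ((0 : ℝ), (1 : ℝ)))

theorem eventually_differentiableAt_axis {V : Type*} [NormedAddCommGroup V] [NormedSpace ℝ V]
    {f : ℝ × ℝ → V} (hf : ContDiffAt ℝ 2 f (0, 0)) :
    ∀ᶠ a : ℝ in 𝓝 0, DifferentiableAt ℝ f (a, 0) := by
  have h : ∀ᶠ z in 𝓝 ((0 : ℝ), (0 : ℝ)), DifferentiableAt ℝ f z :=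
    (hf.eventually (by simp)).mono fun z hz => hz.differentiableAt (by norm_num)
  have hc : ContinuousAt (fun a : ℝ => (a, (0 : ℝ))) 0 := by fun_prop
  exact hc.eventually h

theorem deriv_partial_snd {V : Type*} [NormedAddCommGroup V] [NormedSpace ℝ V]
    {f : ℝ × ℝ → V} {a : ℝ} (hf : DifferentiableAt ℝ f (a, 0)) :
    deriv (fun b : ℝ => f (a, b)) 0 = fderiv ℝ f (a, 0) (0, 1) := by
  have hline : HasDerivAt (fun b : ℝ => (a, b)) (0, 1) 0 :=
    (hasDerivAt_const _ _).prodMk (hasDerivAt_id (0 : ℝ))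
  exact (hf.hasFDerivAt.comp_hasDerivAt (0 : ℝ) hline).deriv

theorem mixedPartial_eq_of_hasDerivAt {f : ℝ × ℝ → ℝ} (hf : ContDiffAt ℝ 2 f (0, 0)) {c : ℝ}
    (h : HasDerivAt (fun a : ℝ => fderiv ℝ f (a, 0) (0, 1)) c 0) : mixedPartial f = c := by
  have he : (fun a : ℝ => deriv (fun b : ℝ => f (a, b)) 0) =ᶠ[𝓝 0]
      fun a : ℝ => fderiv ℝ f (a, 0) (0, 1) :=
    (eventually_differentiableAt_axis hf).mono fun a ha => deriv_partial_snd ha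
  exact (h.congr_of_eventuallyEq he).deriv

theorem mixedPartial_clm_comp {V : Type*} [NormedAddCommGroup V] [NormedSpace ℝ V]
    (L : V →L[ℝ] ℝ) {f : ℝ × ℝ → V} (hf : ContDiffAt ℝ 2 f (0, 0)) :
    mixedPartial (fun z => L (f z)) = L (fderiv ℝ (fderiv ℝ f) (0, 0) (1, 0) (0, 1)) := by
  refine mixedPartial_eq_of_hasDerivAt (L.contDiff.contDiffAt.comp _ hf) ?_
  refine (L.hasFDerivAt.comp_hasDerivAt (0 : ℝ)
    (hasDerivAt_partial_snd hf)).congr_of_eventuallyEq ?_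
  filter_upwards [eventually_differentiableAt_axis hf] with a ha
  have h := L.hasFDerivAt.comp ((a, 0) : ℝ × ℝ) ha.hasFDerivAt
  exact congrArg (fun T => T ((0 : ℝ), (1 : ℝ))) h.fderiv

/-- The chain rule for the mixed second derivative of `u ∘ F` at a fixed point of `F`. -/
theorem hasDerivAt_partial_snd_comp {F : ℝ × ℝ → ℝ × ℝ} {u : ℝ × ℝ → ℝ}
    (hF : ContDiffAt ℝ 2 F (0, 0)) (hF0 : F (0, 0) = (0, 0)) (hu : ContDiffAt ℝ 2 u (0, 0)) :
    HasDerivAt (fun a : ℝ => fderiv ℝ (fun z => u (F z)) (a, 0) (0, 1))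
      (fderiv ℝ (fderiv ℝ u) (0, 0) (fderiv ℝ F (0, 0) (1, 0)) (fderiv ℝ F (0, 0) (0, 1)) +
        fderiv ℝ u (0, 0) (fderiv ℝ (fderiv ℝ F) (0, 0) (1, 0) (0, 1))) 0 := by
  have hline : HasDerivAt (fun a : ℝ => (a, (0 : ℝ))) (1, 0) 0 :=
    (hasDerivAt_id (0 : ℝ)).prodMk (hasDerivAt_const _ _)
  have hFd : HasFDerivAt F (fderiv ℝ F (0, 0)) ((0 : ℝ), (0 : ℝ)) :=
    (hF.differentiableAt (by norm_num)).hasFDerivAt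
  have hFline : HasDerivAt (fun a : ℝ => F (a, 0)) (fderiv ℝ F (0, 0) (1, 0)) 0 :=
    hFd.comp_hasDerivAt (f := fun a : ℝ => (a, (0 : ℝ))) (0 : ℝ) hline
  have hd : HasFDerivAt (fderiv ℝ u) (fderiv ℝ (fderiv ℝ u) (0, 0)) (F ((0 : ℝ), (0 : ℝ))) := by
    rw [hF0]
    exact ((hu.fderiv_right (m := 1) (by norm_num)).differentiableAt (by norm_num)).hasFDerivAt
  have h := (hd.comp_hasDerivAt (f := fun a : ℝ => F (a, 0)) (0 : ℝ) hFline).clm_apply (hasDerivAt_partial_snd hF)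
  simp only [Function.comp_apply, hF0] at h
  refine h.congr_of_eventuallyEq ?_
  have hudiff : ∀ᶠ z in 𝓝 (F ((0 : ℝ), (0 : ℝ))), DifferentiableAt ℝ u z := by
    rw [hF0]
    exact (hu.eventually (by simp)).mono fun z hz => hz.differentiableAt (by norm_num)
  filter_upwards [eventually_differentiableAt_axis hF,
    hFline.continuousAt.eventually hudiff] with a ha hua
  exact congrArg (fun T => T ((0 : ℝ), (1 : ℝ)))
    (hua.hasFDerivAt.comp ((a, 0) : ℝ × ℝ) ha.hasFDerivAt).fderiv

/-- **Lemma 2.1 (computational core).** Let `μ ∈ (0,1)`, let `U` be a neighborhood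
of the origin in `ℝ²` and let `F : U → ℝ²` be a `C²` map fixing the origin with
`DF(0,0) = diag(μ, μ⁻¹)` and vanishing mixed second partials of both components at
the origin.  If `ξ, u` are `C²` on `U` and `ξ' = ξ - u + u ∘ F`, then
`∂²ξ'/∂x∂y(0,0) = ∂²ξ/∂x∂y(0,0)`. -/
theorem mixed_partial_of_return_time_independent_of_transversal
    (μ : ℝ) (hμ : μ ∈ Set.Ioo (0:ℝ) 1)
    (U : Set (ℝ × ℝ)) (hU : U ∈ 𝓝 ((0, 0) : ℝ × ℝ))
    (F : ℝ × ℝ → ℝ × ℝ) (hF : ContDiffOn ℝ 2 F U)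
    (hF0 : F (0, 0) = (0, 0))
    (hDF₁ : fderiv ℝ F (0, 0) (1, 0) = (μ, 0))
    (hDF₂ : fderiv ℝ F (0, 0) (0, 1) = (0, μ⁻¹))
    (hmix₁ : mixedPartialFst F = 0)
    (hmix₂ : mixedPartialSnd F = 0)
    (ξ u : ℝ × ℝ → ℝ)
    (hξ : ContDiffOn ℝ 2 ξ U) (hu : ContDiffOn ℝ 2 u U) :
    mixedPartial (fun z => ξ z - u z + u (F z)) = mixedPartial ξ := by
  have hF' : ContDiffAt ℝ 2 F (0, 0) := hF.contDiffAt hU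
  have hξ' : ContDiffAt ℝ 2 ξ (0, 0) := hξ.contDiffAt hU
  have hu' : ContDiffAt ℝ 2 u (0, 0) := hu.contDiffAt hU
  have huF : ContDiffAt ℝ 2 (fun z => u (F z)) (0, 0) :=
    ContDiffAt.comp _ (by rwa [hF0]) hF'
  have hD2F : fderiv ℝ (fderiv ℝ F) (0, 0) (1, 0) (0, 1) = 0 := by
    refine Prod.ext ?_ ?_
    · exact (mixedPartial_clm_comp (ContinuousLinearMap.fst ℝ ℝ ℝ) hF').symm.trans hmix₁
    · exact (mixedPartial_clm_comp (ContinuousLinearMap.snd ℝ ℝ ℝ) hF').symm.trans hmix₂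
  have hcomp := hasDerivAt_partial_snd_comp hF' hF0 hu'
  have e₁ : ((μ, 0) : ℝ × ℝ) = μ • (1, 0) := by simp
  have e₂ : ((0, μ⁻¹) : ℝ × ℝ) = μ⁻¹ • (0, 1) := by simp
  rw [hD2F, map_zero, add_zero, hDF₁, hDF₂, e₁, e₂, map_smul, map_smul,
    smul_apply, smul_smul, inv_mul_cancel₀ hμ.1.ne', one_smul] at hcomp
  rw [mixedPartial_eq_of_hasDerivAt hξ' (hasDerivAt_partial_snd hξ')]
  refine mixedPartial_eq_of_hasDerivAt ((hξ'.sub hu').add huF) ?_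
  have h := ((hasDerivAt_partial_snd hξ').sub (hasDerivAt_partial_snd hu')).add hcomp
  rw [sub_add_cancel] at h
  refine h.congr_of_eventuallyEq ?_
  filter_upwards [eventually_differentiableAt_axis hξ', eventually_differentiableAt_axis hu',
    eventually_differentiableAt_axis huF] with a h₁ h₂ h₃
  exact congrArg (fun T => T ((0 : ℝ), (1 : ℝ)))
    ((h₁.hasFDerivAt.sub h₂.hasFDerivAt).add h₃.hasFDerivAt).fderiv

end Paper
end
end

section
/- (Moser normal form in low regularity) Let F be a C^r (r>2) area preserving, orientation preserving local diffeomorphism defined on a neighborhood of the origin in ℝ² for which the origin is a hyperbolic saddle fixed point with eigenvalues μ and μ^{-1}, μ ∈ (0,1). Set θ = min{1, r−2} > 0. Then there exists a C^r change of coordinates Ψ fixing the origin such that Ψ^{-1} ∘ F ∘ Ψ(x,y) = (μx + xyφ_1(x,y), μ^{-1}y + xyφ_2(x,y)), where φ_1 and φ_2 are Hölder continuous with exponent θ and vanish at the origin, φ_1(0,0) = φ_2(0,0) = 0. -/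
open scoped Topology NNReal
open Set MeasureTheory

noncomputable section

namespace Paper

/-- `C^n` on a set with `γ`-Hölder `n`-th derivative on that set. -/
def HolderCnFunOn {F G : Type*} [NormedAddCommGroup F] [NormedSpace ℝ F]
    [NormedAddCommGroup G] [NormedSpace ℝ G]
    (n : ℕ) (γ : ℝ) (f : F → G) (s : Set F) : Prop :=
  ContDiffOn ℝ n f s ∧ ∃ C : ℝ≥0,
    HolderOnWith C (Real.toNNReal γ) (iteratedFDerivWithin ℝ n f s) s

/-- `C^r` on a set, for a real exponent `r`: `C^⌊r⌋` with `(r-⌊r⌋)`-Hölder top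
derivative. -/
def CrFunOn {F G : Type*} [NormedAddCommGroup F] [NormedSpace ℝ F]
    [NormedAddCommGroup G] [NormedSpace ℝ G]
    (r : ℝ) (f : F → G) (s : Set F) : Prop :=
  HolderCnFunOn ⌊r⌋₊ (r - ⌊r⌋₊) f s

open Filter

/-- `f` is `γ`-Hölder on some neighborhood of `x`. -/
def HolderNear {E F : Type*} [NormedAddCommGroup E] [NormedAddCommGroup F]
    (γ : ℝ) (f : E → F) (x : E) : Prop :=
  ∃ C : ℝ, ∀ᶠ p : E × E in 𝓝 x ×ˢ 𝓝 x, ‖f p.1 - f p.2‖ ≤ C * ‖p.1 - p.2‖ ^ γ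

/-- `f` is `C^m` at `x` and its `m`-th derivative is `γ`-Hölder near `x`. -/
def CHolderAt {E F : Type*} [NormedAddCommGroup E] [NormedSpace ℝ E]
    [NormedAddCommGroup F] [NormedSpace ℝ F]
    (m : ℕ) (γ : ℝ) (f : E → F) (x : E) : Prop :=
  ContDiffAt ℝ m f x ∧ HolderNear γ (iteratedFDeriv ℝ m f) x

section HolderNear

variable {D E F G : Type*} [NormedAddCommGroup D]
  [NormedAddCommGroup E] [NormedAddCommGroup F] [NormedAddCommGroup G] {γ : ℝ} {x : D}

lemma HolderNear.exists_pos {f : D → E} (h : HolderNear γ f x) :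
    ∃ C : ℝ, 0 < C ∧ ∀ᶠ p : D × D in 𝓝 x ×ˢ 𝓝 x, ‖f p.1 - f p.2‖ ≤ C * ‖p.1 - p.2‖ ^ γ := by
  obtain ⟨C, hC⟩ := h
  refine ⟨max C 1, by positivity, hC.mono fun p hp => hp.trans ?_⟩
  gcongr
  exact le_max_left _ _

lemma HolderNear.exists_ball {f : D → E} (h : HolderNear γ f x) :
    ∃ C : ℝ, 0 < C ∧ ∃ δ > 0, ∀ y ∈ Metric.ball x δ, ∀ z ∈ Metric.ball x δ,
      ‖f y - f z‖ ≤ C * ‖y - z‖ ^ γ := by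
  obtain ⟨C, hC, h⟩ := h.exists_pos
  obtain ⟨t, ht, h⟩ :=
    (eventually_prod_self_iff (r := fun a b => ‖f a - f b‖ ≤ C * ‖a - b‖ ^ γ)).1 h
  obtain ⟨δ, hδ, hb⟩ := Metric.mem_nhds_iff.1 ht
  exact ⟨C, hC, δ, hδ, fun y hy z hz => h y (hb hy) z (hb hz)⟩

lemma HolderNear.of_ball {f : D → E} {C δ : ℝ} (hδ : 0 < δ)
    (h : ∀ y ∈ Metric.ball x δ, ∀ z ∈ Metric.ball x δ, ‖f y - f z‖ ≤ C * ‖y - z‖ ^ γ) :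
    HolderNear γ f x :=
  ⟨C, (eventually_prod_self_iff (r := fun a b => ‖f a - f b‖ ≤ C * ‖a - b‖ ^ γ)).2
    ⟨_, Metric.ball_mem_nhds x hδ, h⟩⟩

lemma HolderNear.congr {f g : D → E} (h : HolderNear γ f x) (hfg : f =ᶠ[𝓝 x] g) :
    HolderNear γ g x := by
  obtain ⟨C, hC⟩ := h
  refine ⟨C, ?_⟩
  filter_upwards [hC, hfg.prod_inl (𝓝 x), hfg.prod_inr (𝓝 x)] with p hp h1 h2
  rwa [← h1, ← h2]

lemma HolderNear.of_le_of_norm_sub {f : D → E} {g : D → F} (h : HolderNear γ f x)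
    (hfg : ∀ y z, ‖g y - g z‖ ≤ ‖f y - f z‖) : HolderNear γ g x := by
  obtain ⟨C, hC⟩ := h
  exact ⟨C, hC.mono fun p hp => (hfg _ _).trans hp⟩

lemma HolderNear.add {f g : D → E} (hf : HolderNear γ f x) (hg : HolderNear γ g x) :
    HolderNear γ (fun y => f y + g y) x := by
  obtain ⟨C, hC⟩ := hf
  obtain ⟨K, hK⟩ := hg
  refine ⟨C + K, ?_⟩
  filter_upwards [hC, hK] with p h1 h2
  calc ‖f p.1 + g p.1 - (f p.2 + g p.2)‖ = ‖(f p.1 - f p.2) + (g p.1 - g p.2)‖ := by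
        congr 1; abel
    _ ≤ _ := norm_add_le _ _
    _ ≤ _ := by rw [add_mul]; exact add_le_add h1 h2

lemma HolderNear.of_one {f : D → E} (hf : HolderNear 1 f x) (h1 : γ ≤ 1) :
    HolderNear γ f x := by
  obtain ⟨C, hC, δ, hδ, h⟩ := hf.exists_ball
  refine HolderNear.of_ball (C := C) (δ := min δ (1 / 2)) (by positivity) fun y hy z hz => ?_
  have hy' := Metric.ball_subset_ball (min_le_left _ _) hy
  have hz' := Metric.ball_subset_ball (min_le_left _ _) hz
  have hyz : ‖y - z‖ ≤ 1 := by
    have h1 := Metric.ball_subset_ball (min_le_right _ _) hy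
    have h2 := Metric.ball_subset_ball (min_le_right _ _) hz
    rw [Metric.mem_ball] at h1 h2
    have := dist_triangle_right y z x
    rw [← dist_eq_norm]; linarith
  refine (h y hy' z hz').trans ?_
  gcongr 1
  rcases (norm_nonneg (y - z)).eq_or_lt with h0 | h0
  · rw [← h0, Real.rpow_one]; exact Real.rpow_nonneg le_rfl _
  · exact Real.rpow_le_rpow_of_exponent_ge h0 hyz h1

lemma HolderNear.comp [NormedSpace ℝ D] {g : E → F} {f : D → E} (hγ : 0 ≤ γ)
    (hg : HolderNear γ g (f x)) (hf : HolderNear 1 f x) (hc : ContinuousAt f x) :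
    HolderNear γ (g ∘ f) x := by
  obtain ⟨C, hC0, hC⟩ := hg.exists_pos
  obtain ⟨K, hK0, hK⟩ := hf.exists_pos
  refine ⟨C * K ^ γ, ?_⟩
  have := (Tendsto.prodMap hc hc).eventually hC
  filter_upwards [this, hK] with p h1 h2
  refine h1.trans ?_
  rw [Real.rpow_one] at h2
  rw [mul_assoc, ← Real.mul_rpow hK0.le (norm_nonneg _)]
  simp only [Prod.map_fst, Prod.map_snd]
  gcongr

lemma HolderNear.bilinear [NormedSpace ℝ D] [NormedSpace ℝ E] [NormedSpace ℝ F] [NormedSpace ℝ G]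
    (B : E →L[ℝ] F →L[ℝ] G) {f : D → E} {g : D → F} (hf : HolderNear γ f x)
    (hg : HolderNear γ g x) (hfc : ContinuousAt f x) (hgc : ContinuousAt g x) :
    HolderNear γ (fun y => B (f y) (g y)) x := by
  obtain ⟨C, hC0, hC⟩ := hf.exists_pos
  obtain ⟨K, hK0, hK⟩ := hg.exists_pos
  have h1 : ∀ᶠ y in 𝓝 x, ‖f y‖ < ‖f x‖ + 1 :=
    hfc.norm.eventually_lt continuousAt_const (by linarith)
  have h2 : ∀ᶠ y in 𝓝 x, ‖g y‖ < ‖g x‖ + 1 :=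
    hgc.norm.eventually_lt continuousAt_const (by linarith)
  refine ⟨‖B‖ * C * (‖g x‖ + 1) + ‖B‖ * (‖f x‖ + 1) * K, ?_⟩
  filter_upwards [hC, hK, h1.prod_inr (𝓝 x), h2.prod_inl (𝓝 x)] with p hp hp' hp1 hp2
  calc ‖B (f p.1) (g p.1) - B (f p.2) (g p.2)‖
      = ‖B (f p.1 - f p.2) (g p.1) + B (f p.2) (g p.1 - g p.2)‖ := by
        congr 1; simp
    _ ≤ ‖B‖ * ‖f p.1 - f p.2‖ * ‖g p.1‖ + ‖B‖ * ‖f p.2‖ * ‖g p.1 - g p.2‖ :=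
        (norm_add_le _ _).trans (add_le_add (B.le_opNorm₂ _ _) (B.le_opNorm₂ _ _))
    _ ≤ ‖B‖ * (C * ‖p.1 - p.2‖ ^ γ) * (‖g x‖ + 1) +
        ‖B‖ * (‖f x‖ + 1) * (K * ‖p.1 - p.2‖ ^ γ) := by gcongr
    _ = _ := by ring

end HolderNear

lemma _root_.ContDiffAt.holderNear_one {E F : Type*} [NormedAddCommGroup E] [NormedSpace ℝ E]
    [NormedAddCommGroup F] [NormedSpace ℝ F] {f : E → F} {x : E} (h : ContDiffAt ℝ 1 f x) :
    HolderNear 1 f x := by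
  obtain ⟨K, t, ht, hK⟩ := h.exists_lipschitzOnWith
  refine ⟨K, (eventually_prod_self_iff (r := fun a b => ‖f a - f b‖ ≤ K * ‖a - b‖ ^ (1 : ℝ))).2
    ⟨t, ht, fun y hy z hz => ?_⟩⟩
  rw [Real.rpow_one]
  exact hK.norm_sub_le hy hz

section CHolderAt

universe u

variable {D E F G : Type u} [NormedAddCommGroup D] [NormedSpace ℝ D]
  [NormedAddCommGroup E] [NormedSpace ℝ E] [NormedAddCommGroup F] [NormedSpace ℝ F]
  [NormedAddCommGroup G] [NormedSpace ℝ G] {γ : ℝ} {m : ℕ} {x : D}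

lemma cHolderAt_zero_iff {f : D → E} :
    CHolderAt 0 γ f x ↔ (∀ᶠ y in 𝓝 x, ContinuousAt f y) ∧ HolderNear γ f x := by
  have key : ∀ y z, ‖iteratedFDeriv ℝ 0 f y - iteratedFDeriv ℝ 0 f z‖ = ‖f y - f z‖ := by
    intro y z
    rw [iteratedFDeriv_zero_eq_comp, Function.comp, Function.comp, ← map_sub,
      LinearIsometryEquiv.norm_map]
  have h0 : ContDiffAt ℝ (0 : ℕ) f x ↔ ∀ᶠ y in 𝓝 x, ContinuousAt f y := by
    rw [Nat.cast_zero, contDiffAt_zero]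
    constructor
    · rintro ⟨u, hu, h⟩
      filter_upwards [eventually_mem_nhds_iff.2 hu] with y hy using h.continuousAt hy
    · intro h
      exact ⟨_, h, fun y hy => hy.continuousWithinAt⟩
  unfold CHolderAt
  rw [h0]
  exact and_congr_right fun _ => ⟨fun h => h.of_le_of_norm_sub fun y z => (key y z).ge,
    fun h => h.of_le_of_norm_sub fun y z => (key y z).le⟩

lemma cHolderAt_succ_iff {f : D → E} :
    CHolderAt (m + 1) γ f x ↔
      (∀ᶠ y in 𝓝 x, DifferentiableAt ℝ f y) ∧ CHolderAt m γ (fderiv ℝ f) x := by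
  have key : ∀ y z, ‖iteratedFDeriv ℝ (m + 1) f y - iteratedFDeriv ℝ (m + 1) f z‖ =
      ‖iteratedFDeriv ℝ m (fderiv ℝ f) y - iteratedFDeriv ℝ m (fderiv ℝ f) z‖ := by
    intro y z
    rw [← dist_eq_norm, ← dist_eq_norm, iteratedFDeriv_succ_eq_comp_right,
      iteratedFDeriv_succ_eq_comp_right]
    exact LinearIsometryEquiv.dist_map _ _ _
  unfold CHolderAt
  constructor
  · rintro ⟨h1, h2⟩
    refine ⟨?_, h1.fderiv_right (by norm_cast), h2.of_le_of_norm_sub fun y z => (key y z).ge⟩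
    filter_upwards [h1.eventually (by simp)] with y hy
      using hy.differentiableAt (by simp)
  · rintro ⟨h1, h2, h3⟩
    refine ⟨?_, h3.of_le_of_norm_sub fun y z => (key y z).le⟩
    push_cast
    exact contDiffAt_succ_iff_hasFDerivAt.2
      ⟨fderiv ℝ f, ⟨_, h1, fun y hy => DifferentiableAt.hasFDerivAt hy⟩, h2⟩

lemma _root_.ContDiffAt.cHolderAt {f : D → E} {n : WithTop ℕ∞} (h : ContDiffAt ℝ n f x)
    (hmn : (m : WithTop ℕ∞) + 1 ≤ n) (h1 : γ ≤ 1) : CHolderAt m γ f x :=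
  ⟨h.of_le (le_self_add.trans hmn),
    (ContDiffAt.holderNear_one (h.iteratedFDeriv_right (by rwa [add_comm]))).of_one h1⟩

lemma CHolderAt.of_lt {f : D → E} {k : ℕ} {γ' : ℝ} (h : CHolderAt m γ f x) (hk : k < m)
    (h1 : γ' ≤ 1) : CHolderAt k γ' f x :=
  h.1.cHolderAt (by exact_mod_cast hk) h1

lemma CHolderAt.of_le {f : D → E} {k : ℕ} (h : CHolderAt m γ f x) (hk : k ≤ m)
    (h1 : γ ≤ 1) : CHolderAt k γ f x := by
  rcases hk.eq_or_lt with rfl | hk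
  · exact h
  · exact h.of_lt hk h1

lemma CHolderAt.continuousAt {f : D → E} (h : CHolderAt m γ f x) : ContinuousAt f x :=
  h.1.continuousAt

lemma CHolderAt.holderNear_one {f : D → E} (h : CHolderAt (m + 1) γ f x) : HolderNear 1 f x :=
  (h.1.of_le (by norm_cast; omega)).holderNear_one

lemma CHolderAt.congr {f g : D → E} (h : CHolderAt m γ f x) (hfg : f =ᶠ[𝓝 x] g) :
    CHolderAt m γ g x :=
  ⟨h.1.congr_of_eventuallyEq hfg.symm, h.2.congr (hfg.iteratedFDeriv ℝ m)⟩

lemma CHolderAt.add {f g : D → E} (hf : CHolderAt m γ f x) (hg : CHolderAt m γ g x) :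
    CHolderAt m γ (fun y => f y + g y) x := by
  refine ⟨hf.1.add hg.1, (hf.2.add hg.2).congr ?_⟩
  filter_upwards [hf.1.eventually (by simp), hg.1.eventually (by simp)] with y h1 h2
  exact (iteratedFDeriv_add_apply h1 h2).symm

lemma CHolderAt.const (c : E) (h1 : γ ≤ 1) : CHolderAt m γ (fun _ : D => c) x :=
  (contDiffAt_const (n := (m : WithTop ℕ∞) + 1)).cHolderAt le_rfl h1

lemma CHolderAt.bilinear {D E F G : Type u} [NormedAddCommGroup D] [NormedSpace ℝ D]
    [NormedAddCommGroup E] [NormedSpace ℝ E] [NormedAddCommGroup F] [NormedSpace ℝ F]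
    [NormedAddCommGroup G] [NormedSpace ℝ G] {x : D} (hγ1 : γ ≤ 1)
    (B : E →L[ℝ] F →L[ℝ] G) {f : D → E} {g : D → F}
    (hf : CHolderAt m γ f x) (hg : CHolderAt m γ g x) :
    CHolderAt m γ (fun y => B (f y) (g y)) x := by
  induction m generalizing E F G with
  | zero =>
    rw [cHolderAt_zero_iff] at *
    refine ⟨?_, hf.2.bilinear B hg.2 hf.1.self_of_nhds hg.1.self_of_nhds⟩
    filter_upwards [hf.1, hg.1] with y h1 h2
    exact (B.continuous.continuousAt.comp h1).clm_apply h2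
  | succ m ih =>
    have hf' := cHolderAt_succ_iff.1 hf
    have hg' := cHolderAt_succ_iff.1 hg
    rw [cHolderAt_succ_iff]
    have hf0 := hf.of_lt (Nat.lt_succ_self m) hγ1
    have hg0 := hg.of_lt (Nat.lt_succ_self m) hγ1
    constructor
    · filter_upwards [hf'.1, hg'.1] with y h1 h2
      exact (B.differentiableAt.comp y h1).clm_apply h2
    · refine ((ih (B.precompR D) hf0 hg'.2).add (ih (B.precompL D) hf'.2 hg0)).congr ?_
      filter_upwards [hf'.1, hg'.1] with y h1 h2
      exact (B.fderiv_of_bilinear h1 h2).symm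

lemma CHolderAt.clm_comp (hγ1 : γ ≤ 1) (L : E →L[ℝ] F) {f : D → E} (hf : CHolderAt m γ f x) :
    CHolderAt m γ (fun y => L (f y)) x :=
  CHolderAt.bilinear hγ1 (ContinuousLinearMap.id ℝ (E →L[ℝ] F)) (CHolderAt.const L hγ1) hf

lemma CHolderAt.clm_apply (hγ1 : γ ≤ 1) {L : D → E →L[ℝ] F} {f : D → E}
    (hL : CHolderAt m γ L x) (hf : CHolderAt m γ f x) :
    CHolderAt m γ (fun y => L y (f y)) x :=
  CHolderAt.bilinear hγ1 (ContinuousLinearMap.id ℝ (E →L[ℝ] F)) hL hf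

lemma CHolderAt.comp {D E F : Type u} [NormedAddCommGroup D] [NormedSpace ℝ D]
    [NormedAddCommGroup E] [NormedSpace ℝ E] [NormedAddCommGroup F] [NormedSpace ℝ F] {x : D}
    (hγ : 0 ≤ γ) (hγ1 : γ ≤ 1) {g : E → F} {f : D → E}
    (hg : CHolderAt m γ g (f x)) (hf : CHolderAt m γ f x) (hf1 : HolderNear 1 f x) :
    CHolderAt m γ (g ∘ f) x := by
  induction m generalizing F with
  | zero =>
    rw [cHolderAt_zero_iff] at *
    have hc := hf.1.self_of_nhds
    refine ⟨?_, hg.2.comp hγ hf1 hc⟩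
    filter_upwards [hf.1, hc.eventually hg.1] with y h1 h2 using ContinuousAt.comp h2 h1
  | succ m ih =>
    have hf' := cHolderAt_succ_iff.1 hf
    have hg' := cHolderAt_succ_iff.1 hg
    rw [cHolderAt_succ_iff]
    have hf0 := hf.of_lt (Nat.lt_succ_self m) hγ1
    have hc := hf.continuousAt.eventually hg'.1
    constructor
    · filter_upwards [hf'.1, hc] with y h1 h2 using h2.comp y h1
    · refine (CHolderAt.bilinear hγ1 (ContinuousLinearMap.compL ℝ D E F)
        (ih hg'.2 hf0) hf'.2).congr ?_
      filter_upwards [hf'.1, hc] with y h1 h2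
      exact (fderiv_comp y h2 h1).symm

lemma CHolderAt.comp' (hγ : 0 ≤ γ) (hγ1 : γ ≤ 1) {g : E → F} {f : D → E}
    (hg : CHolderAt (m + 1) γ g (f x)) (hf : CHolderAt (m + 1) γ f x) :
    CHolderAt (m + 1) γ (fun y => g (f y)) x :=
  CHolderAt.comp hγ hγ1 hg hf hf.holderNear_one

end CHolderAt

lemma cHolderAt_succ_iff_deriv {E : Type} [NormedAddCommGroup E] [NormedSpace ℝ E]
    {m : ℕ} {γ : ℝ} (hγ1 : γ ≤ 1) {f : ℝ → E} {x : ℝ} :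
    CHolderAt (m + 1) γ f x ↔
      (∀ᶠ y in 𝓝 x, DifferentiableAt ℝ f y) ∧ CHolderAt m γ (deriv f) x := by
  rw [cHolderAt_succ_iff]
  refine and_congr_right fun _ => ⟨fun h => ?_, fun h => ?_⟩
  · exact (h.clm_comp hγ1 (ContinuousLinearMap.apply ℝ E (1 : ℝ))).congr
      (.of_forall fun y => by simp)
  · exact (h.clm_comp hγ1
      (ContinuousLinearMap.toSpanSingletonCLE (𝕜 := ℝ) (E := E)).toContinuousLinearMap).congr
      (.of_forall fun y => by rw [← toSpanSingleton_deriv]; rfl)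

section ContractingEquation

lemma le_div_of_le_add_mul {X : Type*} {S : X → X} {s : Set X} (hS : MapsTo S s s)
    {D M : X → ℝ} {K q : ℝ} (hq0 : 0 ≤ q) (hq1 : q < 1) (hK : ∀ x ∈ s, D x ≤ K)
    (hM0 : ∀ x ∈ s, 0 ≤ M x) (hM : ∀ x ∈ s, M (S x) ≤ M x)
    (hD : ∀ x ∈ s, D x ≤ M x + q * D (S x)) :
    ∀ x ∈ s, D x ≤ M x / (1 - q) := by
  have h1q : 0 < 1 - q := by linarith
  have key : ∀ n : ℕ, ∀ x ∈ s, D x ≤ M x / (1 - q) + q ^ n * K := by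
    intro n
    induction n with
    | zero =>
      intro x hx
      have := div_nonneg (hM0 x hx) h1q.le
      have := hK x hx
      simp only [pow_zero, one_mul]
      linarith
    | succ n ih =>
      intro x hx
      calc D x ≤ M x + q * D (S x) := hD x hx
        _ ≤ M x + q * (M (S x) / (1 - q) + q ^ n * K) := by
            gcongr; exact ih _ (hS hx)
        _ ≤ M x + q * (M x / (1 - q) + q ^ n * K) := by
            gcongr; exact hM x hx
        _ = _ := by field_simp; ring
  intro x hx
  have hlim : Tendsto (fun n : ℕ => M x / (1 - q) + q ^ n * K) atTop
      (𝓝 (M x / (1 - q) + 0 * K)) :=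
    tendsto_const_nhds.add ((tendsto_pow_atTop_nhds_zero_of_lt_one hq0 hq1).mul_const K)
  have := ge_of_tendsto' hlim fun n => key n x hx
  simpa using this

lemma eventually_nhds_zero_iff {p : ℝ → Prop} :
    (∀ᶠ t in 𝓝 (0 : ℝ), p t) ↔ ∃ δ > 0, ∀ t, |t| < δ → p t := by
  simp [Metric.eventually_nhds_iff]

lemma eventually_prod_nhds_zero {p : ℝ × ℝ → Prop}
    (h : ∀ᶠ t in 𝓝 (0 : ℝ) ×ˢ 𝓝 (0 : ℝ), p t) :
    ∃ δ > 0, ∀ s t, |s| < δ → |t| < δ → p (s, t) := by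
  obtain ⟨u, hu, h⟩ := (eventually_prod_self_iff (r := fun a b => p (a, b))).1 h
  obtain ⟨δ, hδ, hb⟩ := eventually_nhds_zero_iff.1 hu
  exact ⟨δ, hδ, fun s t hs ht => h s (hb s hs) t (hb t ht)⟩

variable {E : Type} [NormedAddCommGroup E] [NormedSpace ℝ E] {μ : ℝ}

lemma abs_mul_lt_of_lt (hμ0 : 0 < μ) (hμ1 : μ < 1) {t δ : ℝ} (ht : |t| < δ) : |μ * t| < δ := by
  rw [abs_mul, abs_of_pos hμ0]
  nlinarith [abs_nonneg t]

lemma tendsto_const_mul_nhds_zero (μ : ℝ) : Tendsto (fun t => μ * t) (𝓝 0) (𝓝 (0 : ℝ)) :=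
  (continuous_const_mul μ).tendsto' 0 0 (mul_zero _)

lemma norm_sub_le_of_eq {b₁ b₂ w₁ w₂ : E} {C₁ C₂ : E →L[ℝ] E} :
    ‖(b₁ + C₁ w₁) - (b₂ + C₂ w₂)‖ ≤ ‖b₁ - b₂‖ + ‖C₁ - C₂‖ * ‖w₁‖ + ‖C₂‖ * ‖w₁ - w₂‖ := by
  calc ‖(b₁ + C₁ w₁) - (b₂ + C₂ w₂)‖ = ‖(b₁ - b₂) + (C₁ - C₂) w₁ + C₂ (w₁ - w₂)‖ := by
        congr 1; simp; abel
    _ ≤ ‖b₁ - b₂‖ + ‖(C₁ - C₂) w₁‖ + ‖C₂ (w₁ - w₂)‖ := norm_add₃_le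
    _ ≤ _ := by gcongr <;> exact ContinuousLinearMap.le_opNorm _ _

lemma exists_eventually_norm_le {C : ℝ → E →L[ℝ] E} {a c : ℝ} (ha : 0 < a)
    (h : a * ‖C 0‖ < c) (hC : ContinuousAt C 0) (hc : 0 < c) :
    ∃ q, 0 ≤ q ∧ q < c ∧ ∀ᶠ t in 𝓝 (0 : ℝ), a * ‖C t‖ ≤ q := by
  refine ⟨(a * ‖C 0‖ + c) / 2, by positivity, by linarith, ?_⟩
  have : ContinuousAt (fun t => a * ‖C t‖) 0 := continuousAt_const.mul hC.norm
  filter_upwards [this.eventually_lt_const (u := (a * ‖C 0‖ + c) / 2) (by linarith)] with t ht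
  exact ht.le

lemma holderNear_of_eq_add_clm (hμ0 : 0 < μ) (hμ1 : μ < 1) {γ : ℝ} (hγ : 0 ≤ γ) {b w : ℝ → E}
    {C : ℝ → E →L[ℝ] E} (hw : ∀ᶠ t in 𝓝 0, w t = b t + C t (w (μ * t))) {K : ℝ}
    (hK : ∀ᶠ t in 𝓝 0, ‖w t‖ ≤ K) (hC0 : ‖C 0‖ < 1) (hCc : ContinuousAt C 0)
    (hb : HolderNear γ b 0) (hC : HolderNear γ C 0) : HolderNear γ w 0 := by
  obtain ⟨q, hq0, hq1, hq⟩ := exists_eventually_norm_le one_pos (by simpa using hC0) hCc one_pos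
  obtain ⟨Kb, hKb0, hb⟩ := hb.exists_pos
  obtain ⟨Kc, hKc0, hC⟩ := hC.exists_pos
  have hwK := hw.and (hK.and hq)
  obtain ⟨δ, hδ, h⟩ := eventually_prod_nhds_zero
    ((hb.and hC).and ((hwK.prod_inl (𝓝 0)).and (hwK.prod_inr (𝓝 0))))
  have hKnn : 0 ≤ K := (norm_nonneg _).trans (h 0 0 (by simpa) (by simpa)).2.1.2.1
  refine HolderNear.of_ball (C := (Kb + Kc * K) / (1 - q)) hδ ?_
  have := le_div_of_le_add_mul (X := ℝ × ℝ) (S := fun p => (μ * p.1, μ * p.2))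
    (s := {p | |p.1| < δ ∧ |p.2| < δ}) (D := fun p => ‖w p.1 - w p.2‖)
    (M := fun p => (Kb + Kc * K) * ‖p.1 - p.2‖ ^ γ) (K := K + K) (q := q)
    (fun p hp => ⟨abs_mul_lt_of_lt hμ0 hμ1 hp.1, abs_mul_lt_of_lt hμ0 hμ1 hp.2⟩) hq0 hq1
    (fun p hp => by
      obtain ⟨-, h1, h2⟩ := h p.1 p.2 hp.1 hp.2
      exact (norm_sub_le _ _).trans (add_le_add h1.2.1 h2.2.1))
    (fun p _ => by positivity)
    (fun p _ => by
      dsimp only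
      gcongr
      rw [← mul_sub, norm_mul, Real.norm_of_nonneg hμ0.le]
      exact mul_le_of_le_one_left (norm_nonneg _) hμ1.le)
    (fun p hp => by
      obtain ⟨⟨hb, hc⟩, h1, h2⟩ := h p.1 p.2 hp.1 hp.2
      obtain ⟨-, h3, -⟩ := h (μ * p.1) 0 (abs_mul_lt_of_lt hμ0 hμ1 hp.1) (by simpa)
      dsimp only at *
      rw [h1.1, h2.1]
      refine norm_sub_le_of_eq.trans ?_
      have e1 := mul_le_mul hc h3.2.1 (norm_nonneg _) (by positivity)
      have e2 := mul_le_mul_of_nonneg_right h2.2.2 (norm_nonneg (w (μ * p.1) - w (μ * p.2)))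
      rw [one_mul] at e2
      nlinarith)
  intro y hy z hz
  rw [mem_ball_zero_iff, Real.norm_eq_abs] at hy hz
  refine (this (y, z) ⟨hy, hz⟩).trans_eq ?_
  ring

lemma eventually_continuousAt_of_eq_add_clm (hμ0 : 0 < μ) (hμ1 : μ < 1) {b w : ℝ → E}
    {C : ℝ → E →L[ℝ] E} (hw : ∀ᶠ t in 𝓝 0, w t = b t + C t (w (μ * t))) {K : ℝ}
    (hK : ∀ᶠ t in 𝓝 0, ‖w t‖ ≤ K) (hC0 : ‖C 0‖ < 1)
    (hb : ∀ᶠ t in 𝓝 0, ContinuousAt b t) (hC : ∀ᶠ t in 𝓝 0, ContinuousAt C t) :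
    ∀ᶠ t in 𝓝 0, ContinuousAt w t := by
  obtain ⟨q, hq0, hq1, hq⟩ := exists_eventually_norm_le one_pos (by simpa using hC0)
    hC.self_of_nhds one_pos
  obtain ⟨δ', hδ', h⟩ := eventually_nhds_zero_iff.1 (hw.and (hK.and (hq.and (hb.and hC))))
  obtain ⟨δ, hδ, hδδ'⟩ := exists_between hδ'
  have hKnn : 0 ≤ K := (norm_nonneg _).trans (h 0 (by simpa)).2.1
  have hcomp : IsCompact (Icc (-δ) δ) := isCompact_Icc
  have hmem : ∀ t ∈ Icc (-δ) δ, |t| < δ' := fun t ht => (abs_le.2 ht).trans_lt hδδ'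
  have hub := hcomp.uniformContinuousOn_of_continuous (f := b) fun t ht =>
    (h t (hmem t ht)).2.2.2.1.continuousWithinAt
  have huC := hcomp.uniformContinuousOn_of_continuous (f := C) fun t ht =>
    (h t (hmem t ht)).2.2.2.2.continuousWithinAt
  rw [Metric.uniformContinuousOn_iff] at hub huC
  refine eventually_nhds_zero_iff.2 ⟨δ, hδ, fun t ht => ?_⟩
  rw [Metric.continuousAt_iff]
  intro ε hε
  have h1q : 0 < 1 - q := by linarith
  set ε' := ε * (1 - q) / (2 * (1 + K)) with hε'
  have hε'0 : 0 < ε' := by positivity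
  obtain ⟨η₁, hη₁, hb'⟩ := hub ε' hε'0
  obtain ⟨η₂, hη₂, hC'⟩ := huC ε' hε'0
  have := le_div_of_le_add_mul (X := ℝ × ℝ) (S := fun p => (μ * p.1, μ * p.2))
    (s := {p | (|p.1| < δ ∧ |p.2| < δ) ∧ |p.1 - p.2| < min η₁ η₂})
    (D := fun p => ‖w p.1 - w p.2‖)
    (M := fun _ => ε' + ε' * K) (K := K + K) (q := q)
    (fun p hp => ⟨⟨abs_mul_lt_of_lt hμ0 hμ1 hp.1.1, abs_mul_lt_of_lt hμ0 hμ1 hp.1.2⟩, by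
      dsimp only; rw [← mul_sub]; exact abs_mul_lt_of_lt hμ0 hμ1 hp.2⟩) hq0 hq1
    (fun p hp => (norm_sub_le _ _).trans
      (add_le_add (h _ (hp.1.1.trans hδδ')).2.1 (h _ (hp.1.2.trans hδδ')).2.1))
    (fun p _ => by positivity) (fun p _ => le_rfl)
    (fun p hp => by
      obtain ⟨⟨hp1, hp2⟩, hp3⟩ := hp
      dsimp only
      rw [(h _ (hp1.trans hδδ')).1, (h _ (hp2.trans hδδ')).1]
      refine norm_sub_le_of_eq.trans ?_
      have e0 := hb' p.1 (abs_le.1 hp1.le) p.2 (abs_le.1 hp2.le)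
        (hp3.trans_le (min_le_left _ _))
      have e1 := hC' p.1 (abs_le.1 hp1.le) p.2 (abs_le.1 hp2.le)
        (hp3.trans_le (min_le_right _ _))
      rw [dist_eq_norm] at e0 e1
      have e3 := mul_le_mul e1.le (h _ ((abs_mul_lt_of_lt hμ0 hμ1 hp1).trans hδδ')).2.1
        (norm_nonneg _) hε'0.le
      have e2 := mul_le_mul_of_nonneg_right (h _ (hp2.trans hδδ')).2.2.1
        (norm_nonneg (w (μ * p.1) - w (μ * p.2)))
      rw [one_mul] at e2
      linarith)
  refine ⟨min (min η₁ η₂) (δ - |t|), lt_min (lt_min hη₁ hη₂) (by linarith), fun {s} hs => ?_⟩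
  rw [Real.dist_eq, lt_min_iff] at hs
  have hsδ : |s| < δ := by
    have := abs_add_le (s - t) t
    rw [sub_add_cancel] at this
    linarith [hs.2]
  rw [dist_eq_norm]
  refine (this (s, t) ⟨⟨hsδ, ht⟩, hs.1⟩).trans_lt ?_
  rw [hε', div_lt_iff₀ h1q]
  field_simp
  nlinarith

lemma exists_uniform_deriv_approx {f : ℝ → E} (hf : ContDiffAt ℝ 1 f 0) :
    ∃ δ > 0, ∀ ε > 0, ∃ η > 0, ∀ x h : ℝ, |x| < δ → |h| < η →
      ‖f (x + h) - f x - h • deriv f x‖ ≤ ε * |h| := by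
  obtain ⟨δ, hδ, H⟩ := eventually_nhds_zero_iff.1 (hf.eventually (by simp))
  have hcomp : IsCompact (Icc (-(δ / 2)) (δ / 2)) := isCompact_Icc
  have hd : UniformContinuousOn (deriv f) (Icc (-(δ / 2)) (δ / 2)) :=
    hcomp.uniformContinuousOn_of_continuous fun t ht => by
      have h1 := H t (by have := abs_le.2 ht; linarith)
      have h2 : ContinuousAt (fderiv ℝ f) t :=
        (h1.fderiv_right (m := 0) (by simp)).continuousAt
      have h3 : deriv f = fun t => fderiv ℝ f t 1 := by ext t; simp
      rw [h3]
      exact (h2.clm_apply continuousAt_const).continuousWithinAt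
  rw [Metric.uniformContinuousOn_iff] at hd
  refine ⟨δ / 4, by positivity, fun ε hε => ?_⟩
  obtain ⟨η, hη, hd⟩ := hd ε hε
  refine ⟨min η (δ / 4), by positivity, fun x h hx hh => ?_⟩
  rw [lt_min_iff] at hh
  have hsub : ∀ y ∈ uIcc x (x + h), |y - x| ≤ |h| := fun y hy => by
    have := abs_sub_left_of_mem_uIcc hy
    simpa using this
  have hlt : ∀ y ∈ uIcc x (x + h), |y| < δ / 2 := fun y hy => by
    have := abs_add_le (y - x) x
    rw [sub_add_cancel] at this
    linarith [hsub y hy, hh.2]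
  have := (convex_uIcc x (x + h)).norm_image_sub_le_of_norm_hasDerivWithin_le
    (f := fun y => f y - (y - x) • deriv f x) (f' := fun y => deriv f y - (1 : ℝ) • deriv f x)
    (C := ε) (x := x) (y := x + h)
    (fun y hy => ((((H y (by linarith [hlt y hy])).differentiableAt (by simp)).hasDerivAt.sub
      (((hasDerivAt_id y).sub_const x).smul_const (deriv f x)))).hasDerivWithinAt)
    (fun y hy => by
      have := hd y (abs_le.1 (hlt y hy).le) x (abs_le.1 (by linarith)) (by
        rw [Real.dist_eq]; exact (hsub y hy).trans_lt hh.1)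
      rw [one_smul, ← dist_eq_norm]
      exact this.le) left_mem_uIcc right_mem_uIcc
  simpa [sub_right_comm] using this

lemma eventually_differentiableAt_of_eq_add_clm [CompleteSpace E] (hμ0 : 0 < μ) (hμ1 : μ < 1)
    {b w : ℝ → E} {C : ℝ → E →L[ℝ] E} (hw : ∀ᶠ t in 𝓝 0, w t = b t + C t (w (μ * t)))
    (hL : HolderNear 1 w 0) (hC0 : μ * ‖C 0‖ < 1)
    (hb : ContDiffAt ℝ 1 b 0) (hC : ContDiffAt ℝ 1 C 0) :
    ∀ᶠ t in 𝓝 0, DifferentiableAt ℝ w t := by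
  obtain ⟨q, hq0, hq1, hq⟩ := exists_eventually_norm_le hμ0 hC0 hC.continuousAt one_pos
  obtain ⟨δb, hδb, hb⟩ := exists_uniform_deriv_approx hb
  obtain ⟨Lc, hLc0, hLc⟩ := hC.holderNear_one.exists_pos
  obtain ⟨δc, hδc, hC⟩ := exists_uniform_deriv_approx hC
  obtain ⟨Lw, hLw0, hLw⟩ := hL.exists_pos
  obtain ⟨δ', hδ', H⟩ := eventually_prod_nhds_zero
    ((hLc.and hLw).and ((hw.and hq).prod_inl (𝓝 0)))
  simp only [Real.rpow_one, Real.norm_eq_abs] at H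
  set K := ‖w 0‖ + Lw * δ'
  have hK : ∀ t, |t| < δ' → ‖w t‖ ≤ K := fun t ht => by
    have h1 := (H t 0 ht (by simpa)).1.2
    rw [sub_zero] at h1
    have h2 := norm_add_le (w t - w 0) (w 0)
    rw [sub_add_cancel] at h2
    have := mul_le_mul_of_nonneg_left ht.le hLw0.le
    linarith
  have hK0 : 0 ≤ K := by positivity
  set Q : ℝ → ℝ → E := fun x h => h⁻¹ • (w (x + h) - w x) with hQ
  set δ := min (min δb δc) (δ' / 2) with hδ
  have hδ0 : 0 < δ := by positivity
  have hδb' : δ ≤ δb := (min_le_left _ _).trans (min_le_left _ _)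
  have hδc' : δ ≤ δc := (min_le_left _ _).trans (min_le_right _ _)
  have hδδ' : δ ≤ δ' / 2 := min_le_right _ _
  have hadd : ∀ x h, |x| < δ → |h| < δ → |x + h| < δ' := fun x h hx hh => by
    have := abs_add_le x h
    linarith
  have step : ∀ ε > 0, ∃ η > 0, η ≤ δ ∧ ∀ x h : ℝ, |x| < δ → h ≠ 0 → |h| < η →
      ‖Q x h - (deriv b x + deriv C x (w (μ * x))) - μ • C x (Q (μ * x) (μ * h))‖ ≤ ε := by
    intro ε hε
    set ε' := ε / (2 * (1 + K))
    have hε' : 0 < ε' := by positivity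
    obtain ⟨ηb, hηb, hb⟩ := hb ε' hε'
    obtain ⟨ηc, hηc, hC⟩ := hC ε' hε'
    refine ⟨min (min ηb ηc) (min δ (ε / (2 * Lc * Lw))), by positivity,
      (min_le_right _ _).trans (min_le_left _ _), fun x h hx h0 hh => ?_⟩
    simp only [lt_min_iff] at hh
    obtain ⟨⟨hh1, hh2⟩, hh3, hh4⟩ := hh
    have hxδ' : |x| < δ' := by linarith
    have hxh := hadd x h hx hh3
    have hμx := abs_mul_lt_of_lt hμ0 hμ1 hxδ'
    have hμxh := abs_mul_lt_of_lt hμ0 hμ1 hxh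
    have hwx := (H x 0 hxδ' (by simpa)).2.1
    have hwxh := (H (x + h) 0 hxh (by simpa)).2.1
    have e : Q x h - (deriv b x + deriv C x (w (μ * x))) - μ • C x (Q (μ * x) (μ * h)) =
        h⁻¹ • ((b (x + h) - b x - h • deriv b x) +
          (C (x + h) - C x - h • deriv C x) (w (μ * x)) +
          (C (x + h) - C x) (w (μ * (x + h)) - w (μ * x))) := by
      simp only [hQ]
      rw [hwx, hwxh, ← mul_add, map_smul, smul_smul, mul_inv, mul_inv_cancel_left₀ hμ0.ne',
        ← smul_right_injective E h0 |>.eq_iff]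
      simp only [smul_sub, smul_add, smul_smul, mul_inv_cancel₀ h0, one_smul, map_sub,
        inv_mul_cancel₀ h0,
        sub_apply, smul_apply]
      abel
    rw [e, norm_smul, norm_inv, Real.norm_eq_abs, inv_mul_le_iff₀ (abs_pos.2 h0)]
    have e1 := hb x h (hx.trans_le hδb') hh1
    have e2 : ‖(C (x + h) - C x - h • deriv C x) (w (μ * x))‖ ≤ ε' * |h| * K :=
      (ContinuousLinearMap.le_opNorm _ _).trans
        (mul_le_mul (hC x h (hx.trans_le hδc') hh2) (hK _ hμx) (norm_nonneg _) (by positivity))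
    have e3 : ‖(C (x + h) - C x) (w (μ * (x + h)) - w (μ * x))‖ ≤ (Lc * |h|) * (Lw * |h|) := by
      refine (ContinuousLinearMap.le_opNorm _ _).trans ?_
      have h1 := (H (x + h) x hxh hxδ').1.1
      have h2 := (H (μ * (x + h)) (μ * x) hμxh hμx).1.2
      rw [← mul_sub, abs_mul, abs_of_pos hμ0] at h2
      rw [add_sub_cancel_left] at h1 h2
      refine mul_le_mul h1 (h2.trans ?_) (norm_nonneg _) (by positivity)
      gcongr
      exact mul_le_of_le_one_left (abs_nonneg _) hμ1.le
    have e4 : Lc * Lw * |h| ≤ ε / 2 := by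
      rw [lt_div_iff₀ (by positivity)] at hh4
      linarith
    have e5 : ε' * (1 + K) = ε / 2 := by simp only [ε']; field_simp
    refine norm_add₃_le.trans ?_
    calc _ ≤ ε' * |h| + ε' * |h| * K + (Lc * |h|) * (Lw * |h|) := add_le_add_three e1 e2 e3
      _ = |h| * (ε' * (1 + K) + Lc * Lw * |h|) := by ring
      _ ≤ |h| * ε := by
        gcongr
        linarith
  refine eventually_nhds_zero_iff.2 ⟨δ, hδ0, fun x hx => ?_⟩
  suffices hc : Cauchy (map (Q x) (𝓝[≠] 0)) by
    obtain ⟨d, hd⟩ := cauchy_map_iff_exists_tendsto.1 hc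
    exact (hasDerivAt_iff_tendsto_slope_zero.2 hd).differentiableAt
  refine Metric.cauchy_iff.2 ⟨inferInstance, fun ε hε => ?_⟩
  have h1q : 0 < 1 - q := by linarith
  obtain ⟨η, hη, hηδ, hstep⟩ := step (ε * (1 - q) / 4) (by positivity)
  have := le_div_of_le_add_mul (X := ℝ × ℝ × ℝ)
    (S := fun p => (μ * p.1, μ * p.2.1, μ * p.2.2))
    (s := {p | |p.1| < δ ∧ (p.2.1 ≠ 0 ∧ |p.2.1| < η) ∧ (p.2.2 ≠ 0 ∧ |p.2.2| < η)})
    (D := fun p => ‖Q p.1 p.2.1 - Q p.1 p.2.2‖)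
    (M := fun _ => ε * (1 - q) / 4 + ε * (1 - q) / 4) (K := Lw + Lw) (q := q)
    (fun p hp => ⟨abs_mul_lt_of_lt hμ0 hμ1 hp.1,
      ⟨mul_ne_zero hμ0.ne' hp.2.1.1, abs_mul_lt_of_lt hμ0 hμ1 hp.2.1.2⟩,
      ⟨mul_ne_zero hμ0.ne' hp.2.2.1, abs_mul_lt_of_lt hμ0 hμ1 hp.2.2.2⟩⟩) hq0 hq1
    (fun p hp => by
      have hQL : ∀ x h, |x| < δ → h ≠ 0 → |h| < η → ‖Q x h‖ ≤ Lw := fun x h hx h0 hh => by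
        have := (H (x + h) x (hadd x h hx (by linarith)) (by linarith)).1.2
        rw [add_sub_cancel_left] at this
        rw [hQ, norm_smul, norm_inv, Real.norm_eq_abs, inv_mul_le_iff₀ (abs_pos.2 h0)]
        linarith
      exact (norm_sub_le _ _).trans (add_le_add (hQL _ _ hp.1 hp.2.1.1 hp.2.1.2)
        (hQL _ _ hp.1 hp.2.2.1 hp.2.2.2)))
    (fun p _ => by positivity) (fun p _ => le_rfl)
    (fun p hp => by
      obtain ⟨hx, ⟨h0, hh⟩, k0, hk⟩ := hp
      have e1 := hstep _ _ hx h0 hh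
      have e2 := hstep _ _ hx k0 hk
      have hCx := (H p.1 0 (by linarith) (by simpa)).2.2
      have e3 : ‖μ • C p.1 (Q (μ * p.1) (μ * p.2.1) - Q (μ * p.1) (μ * p.2.2))‖ ≤
          q * ‖Q (μ * p.1) (μ * p.2.1) - Q (μ * p.1) (μ * p.2.2)‖ := by
        rw [norm_smul, Real.norm_of_nonneg hμ0.le]
        refine (mul_le_mul_of_nonneg_left (ContinuousLinearMap.le_opNorm _ _) hμ0.le).trans ?_
        rw [← mul_assoc]
        gcongr
      rw [norm_sub_rev] at e2
      refine le_trans (le_of_eq_of_le ?_ norm_add₃_le) (add_le_add_three e1 e2 e3)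
      congr 1
      rw [map_sub, smul_sub]
      abel)
  refine ⟨Q x '' {h | h ≠ 0 ∧ |h| < η}, image_mem_map ?_, ?_⟩
  · have h1 : ∀ᶠ h in 𝓝[≠] (0 : ℝ), |h| < η :=
      (eventually_nhds_zero_iff.2 ⟨η, hη, fun t ht => ht⟩).filter_mono nhdsWithin_le_nhds
    filter_upwards [h1, self_mem_nhdsWithin] with h h1 h2 using ⟨h2, h1⟩
  · rintro _ ⟨h, hh, rfl⟩ _ ⟨k, hk, rfl⟩
    rw [dist_eq_norm]
    refine (this (x, h, k) ⟨hx, hh, hk⟩).trans_lt ?_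
    rw [div_lt_iff₀ h1q]
    nlinarith

lemma eventually_deriv_eq_of_eq_add_clm {b w : ℝ → E} {C : ℝ → E →L[ℝ] E}
    (hw : ∀ᶠ t in 𝓝 0, w t = b t + C t (w (μ * t)))
    (hd : ∀ᶠ t in 𝓝 0, DifferentiableAt ℝ w t)
    (hb : ∀ᶠ t in 𝓝 0, DifferentiableAt ℝ b t) (hC : ∀ᶠ t in 𝓝 0, DifferentiableAt ℝ C t) :
    ∀ᶠ t in 𝓝 0, deriv w t =
      (deriv b t + deriv C t (w (μ * t))) + (μ • C t) (deriv w (μ * t)) := by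
  filter_upwards [hw.eventually_nhds, hb, hC, (tendsto_const_mul_nhds_zero μ).eventually hd]
    with t h1 h2 h3 h4
  rw [EventuallyEq.deriv_eq h1]
  have h5 : HasDerivAt (fun t => w (μ * t)) (μ • deriv w (μ * t)) t := by
    have := h4.hasDerivAt.scomp t ((hasDerivAt_id t).const_mul μ)
    simpa [Function.comp_def] using this
  refine (h2.hasDerivAt.add (h3.hasDerivAt.clm_apply h5)).deriv.trans ?_
  simp [add_assoc]

lemma CHolderAt.comp_const_mul {F : Type} [NormedAddCommGroup F] [NormedSpace ℝ F] {m : ℕ}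
    {γ : ℝ} (hγ : 0 ≤ γ) (hγ1 : γ ≤ 1) {f : ℝ → F}
    (hf : CHolderAt m γ f 0) (μ : ℝ) : CHolderAt m γ (fun t => f (μ * t)) 0 := by
  have h : ContDiff ℝ ⊤ fun t : ℝ => μ * t := contDiff_const.mul contDiff_id
  refine CHolderAt.comp (g := f) (f := fun t => μ * t) hγ hγ1 (by simpa using hf)
    (h.contDiffAt.cHolderAt le_top hγ1) ?_
  exact (h.contDiffAt.of_le le_top).holderNear_one

lemma CHolderAt.of_eq_add_clm_of_contracting [CompleteSpace E] (hμ0 : 0 < μ) (hμ1 : μ < 1) {γ : ℝ}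
    (hγ : 0 ≤ γ) (hγ1 : γ ≤ 1) {m : ℕ} {b w : ℝ → E} {C : ℝ → E →L[ℝ] E}
    (hw : ∀ᶠ t in 𝓝 0, w t = b t + C t (w (μ * t)))
    (hK : ∃ K, ∀ᶠ t in 𝓝 0, ‖w t‖ ≤ K) (hC0 : ‖C 0‖ < 1)
    (hb : CHolderAt m γ b 0) (hC : CHolderAt m γ C 0) : CHolderAt m γ w 0 := by
  obtain ⟨K, hK⟩ := hK
  induction m generalizing b w C K with
  | zero =>
    rw [cHolderAt_zero_iff] at *
    exact ⟨eventually_continuousAt_of_eq_add_clm hμ0 hμ1 hw hK hC0 hb.1 hC.1,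
      holderNear_of_eq_add_clm hμ0 hμ1 hγ hw hK hC0 hC.1.self_of_nhds hb.2 hC.2⟩
  | succ m ih =>
    have hL := holderNear_of_eq_add_clm hμ0 hμ1 zero_le_one hw hK hC0 hC.continuousAt
      hb.holderNear_one hC.holderNear_one
    have hb1 := (cHolderAt_succ_iff_deriv hγ1).1 hb
    have hC1 := (cHolderAt_succ_iff_deriv hγ1).1 hC
    have hμC0 : μ * ‖C 0‖ < 1 := by nlinarith [norm_nonneg (C 0)]
    have hd := eventually_differentiableAt_of_eq_add_clm hμ0 hμ1 hw hL hμC0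
      (hb.1.of_le (by norm_cast; omega)) (hC.1.of_le (by norm_cast; omega))
    have hb0 := hb.of_lt m.lt_succ_self hγ1
    have hC0' := hC.of_lt m.lt_succ_self hγ1
    have hw0 := ih hw hC0 hb0 hC0' K hK
    refine (cHolderAt_succ_iff_deriv hγ1).2 ⟨hd, ?_⟩
    obtain ⟨Lw, hLw0, δ, hδ, hLw⟩ := hL.exists_ball
    refine ih (b := fun t => deriv b t + deriv C t (w (μ * t))) (C := fun t => μ • C t)
      (eventually_deriv_eq_of_eq_add_clm hw hd hb1.1 hC1.1) ?_ ?_ ?_ Lw ?_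
    · rwa [norm_smul, Real.norm_of_nonneg hμ0.le]
    · exact hb1.2.add (hC1.2.clm_apply hγ1 (hw0.comp_const_mul hγ hγ1 μ))
    · exact CHolderAt.clm_comp hγ1 (μ • ContinuousLinearMap.id ℝ (E →L[ℝ] E)) hC0'
    · filter_upwards [Metric.ball_mem_nhds (0 : ℝ) hδ] with t ht
      refine norm_deriv_le_of_lip' hLw0.le ?_
      filter_upwards [Metric.isOpen_ball.mem_nhds ht] with s hs
      simpa using hLw s hs t ht

/-- A Lipschitz solution of `u(t) = B(t) u(μ t)` is as regular as `B`. -/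
lemma CHolderAt.succ_of_eq_clm [CompleteSpace E] (hμ0 : 0 < μ) (hμ1 : μ < 1) {γ : ℝ}
    (hγ : 0 ≤ γ) (hγ1 : γ ≤ 1) {m : ℕ} {u : ℝ → E} {B : ℝ → E →L[ℝ] E}
    (hu : ∀ᶠ t in 𝓝 0, u t = B t (u (μ * t))) (hL : HolderNear 1 u 0) (hB0 : μ * ‖B 0‖ < 1)
    (hB : CHolderAt (m + 1) γ B 0) (hum : CHolderAt m γ u 0) : CHolderAt (m + 1) γ u 0 := by
  have hw : ∀ᶠ t in 𝓝 0, u t = (fun _ => (0 : E)) t + B t (u (μ * t)) := by simpa using hu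
  have hd := eventually_differentiableAt_of_eq_add_clm hμ0 hμ1 hw hL hB0
    contDiffAt_const (hB.1.of_le (by norm_cast; omega))
  have hB1 := (cHolderAt_succ_iff_deriv hγ1).1 hB
  refine (cHolderAt_succ_iff_deriv hγ1).2 ⟨hd, ?_⟩
  obtain ⟨Lw, hLw0, δ, hδ, hLw⟩ := hL.exists_ball
  refine CHolderAt.of_eq_add_clm_of_contracting hμ0 hμ1 hγ hγ1
    (b := fun t => deriv (fun _ => (0 : E)) t + deriv B t (u (μ * t))) (C := fun t => μ • B t)
    (eventually_deriv_eq_of_eq_add_clm hw hd (by simp) hB1.1) ⟨Lw, ?_⟩ ?_ ?_ ?_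
  · filter_upwards [Metric.ball_mem_nhds (0 : ℝ) hδ] with t ht
    refine norm_deriv_le_of_lip' hLw0.le ?_
    filter_upwards [Metric.isOpen_ball.mem_nhds ht] with s hs
    simpa using hLw s hs t ht
  · rwa [norm_smul, Real.norm_of_nonneg hμ0.le]
  · simpa using hB1.2.clm_apply hγ1 (hum.comp_const_mul hγ hγ1 μ)
  · exact CHolderAt.clm_comp hγ1 (μ • ContinuousLinearMap.id ℝ (E →L[ℝ] E))
      (hB.of_lt m.lt_succ_self hγ1)

end ContractingEquation

section InvariantCurve

lemma norm_le_of_hasDerivAt_of_zero {E : Type*} [NormedAddCommGroup E] [NormedSpace ℝ E]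
    {W u : ℝ → E} {ε c t : ℝ} (hW0 : W 0 = 0) (ht : |t| < ε)
    (hd : ∀ s, |s| < ε → HasDerivAt W (u s) s) (hc : ∀ s, |s| ≤ |t| → ‖u s‖ ≤ c) :
    ‖W t‖ ≤ c * |t| := by
  have hmem : ∀ s ∈ uIcc 0 t, |s| ≤ |t| := fun s hs => by
    simpa using abs_sub_left_of_mem_uIcc hs
  have := (convex_uIcc 0 t).norm_image_sub_le_of_norm_hasDerivWithin_le
    (fun s hs => (hd s ((hmem s hs).trans_lt ht)).hasDerivWithinAt)
    (fun s hs => hc s (hmem s hs)) left_mem_uIcc right_mem_uIcc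
  simpa [hW0] using this

variable {E : Type} [NormedAddCommGroup E] [NormedSpace ℝ E] {μ : ℝ}

/-- The curves `Gⁿ(μⁿ t v)` converge to an invariant curve of `G`. -/
lemma exists_invariant_curve [CompleteSpace E] (hμ0 : 0 < μ) (hμ1 : μ < 1) {G : E → E}
    (hG : ContDiffAt ℝ 2 G 0) (hG0 : G 0 = 0) {v : E} (hv : ‖v‖ ≤ 1)
    (hA : ‖fderiv ℝ G 0‖ ≤ μ⁻¹) (hAv : fderiv ℝ G 0 v = μ⁻¹ • v) :
    ∃ W u : ℝ → E, W 0 = 0 ∧ u 0 = v ∧ (∀ᶠ t in 𝓝 0, HasDerivAt W (u t) t) ∧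
      HolderNear 1 u 0 ∧ ∀ᶠ t in 𝓝 0, W t = G (W (μ * t)) := by
  obtain ⟨L, hL0, ρ₁, hρ₁, hL⟩ :=
    (hG.fderiv_right (m := 1) (by norm_num)).holderNear_one.exists_ball
  obtain ⟨ρ₂, hρ₂, hGd⟩ := Metric.eventually_nhds_iff_ball.1 (hG.eventually (by simp))
  set ρ := min ρ₁ ρ₂
  have hρ : 0 < ρ := by positivity
  simp only [mem_ball_zero_iff, Real.rpow_one] at hL hGd
  replace hL : ∀ y z : E, ‖y‖ < ρ → ‖z‖ < ρ → ‖fderiv ℝ G y - fderiv ℝ G z‖ ≤ L * ‖y - z‖ :=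
    fun y z hy hz => hL y (hy.trans_le (min_le_left _ _)) z (hz.trans_le (min_le_left _ _))
  replace hGd : ∀ y : E, ‖y‖ < ρ → HasFDerivAt G (fderiv ℝ G y) y := fun y hy =>
    ((hGd y (hy.trans_le (min_le_right _ _))).differentiableAt (by simp)).hasFDerivAt
  have hμsub : 0 < 1 - μ := by linarith
  set ε := min (ρ / 2) ((1 - μ) / (8 * L)) with hε
  have hε0 : 0 < ε := by positivity
  have hερ : 2 * ε ≤ ρ := by have := min_le_left (ρ / 2) ((1 - μ) / (8 * L)); linarith
  have hεL : 8 * L * ε ≤ 1 - μ := by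
    have := min_le_right (ρ / 2) ((1 - μ) / (8 * L))
    rw [← hε, le_div_iff₀ (by positivity)] at this
    linarith
  set M := 8 * L / (1 - μ) with hM
  have hM0 : 0 < M := by positivity
  have hMε : M * ε ≤ 1 := by rw [hM, div_mul_eq_mul_div, div_le_one hμsub]; exact hεL
  have hM1 : M * (1 - μ) = 8 * L := by rw [hM]; field_simp
  have hμt : ∀ {t}, |t| < ε → |μ * t| < ε := fun ht => abs_mul_lt_of_lt hμ0 hμ1 ht
  have hμle : ∀ t, |μ * t| ≤ |t| := fun t => by
    rw [abs_mul, abs_of_pos hμ0]; exact mul_le_of_le_one_left (abs_nonneg _) hμ1.le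
  let W : ℕ → ℝ → E := fun n => n.rec (fun t => t • v) fun _ W t => G (W (μ * t))
  have hWs : ∀ n t, W (n + 1) t = G (W n (μ * t)) := fun n t => rfl
  let u : ℕ → ℝ → E := fun n =>
    n.rec (fun _ => v) fun n u t => μ • fderiv ℝ G (W n (μ * t)) (u (μ * t))
  have hus : ∀ n t, u (n + 1) t = μ • fderiv ℝ G (W n (μ * t)) (u n (μ * t)) := fun n t => rfl
  have hW0 : ∀ n, W n 0 = 0 := by
    intro n
    induction n with
    | zero => simp [W]
    | succ n ih => rw [hWs, mul_zero, ih, hG0]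
  have hu0 : ∀ n, u n 0 = v := by
    intro n
    induction n with
    | zero => simp [u]
    | succ n ih => rw [hus, mul_zero, ih, hW0, hAv, smul_smul, mul_inv_cancel₀ hμ0.ne', one_smul]
  have hu2 : ∀ n, (∀ s t, |s| < ε → |t| < ε → ‖u n s - u n t‖ ≤ M * |s - t|) →
      ∀ t, |t| < ε → ‖u n t‖ ≤ 2 := by
    intro n h t ht
    have h1 := h t 0 ht (by simpa)
    rw [sub_zero, hu0] at h1
    have h2 := norm_add_le (u n t - v) v
    rw [sub_add_cancel] at h2
    have := mul_le_mul_of_nonneg_left ht.le hM0.le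
    linarith
  have hDG : ∀ z : E, ‖z‖ ≤ 2 * ε → ‖z‖ < ρ → ‖μ • fderiv ℝ G z‖ ≤ 1 + (1 - μ) / 4 := by
    intro z hz hzρ
    have h1 := hL z 0 hzρ (by simpa)
    rw [sub_zero] at h1
    have h2 := norm_add_le (fderiv ℝ G z - fderiv ℝ G 0) (fderiv ℝ G 0)
    rw [sub_add_cancel] at h2
    rw [norm_smul, Real.norm_of_nonneg hμ0.le]
    have h3 : ‖fderiv ℝ G z‖ ≤ L * (2 * ε) + μ⁻¹ := by
      have := mul_le_mul_of_nonneg_left hz hL0.le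
      linarith
    calc μ * ‖fderiv ℝ G z‖ ≤ μ * (L * (2 * ε) + μ⁻¹) := by gcongr
      _ = μ * (L * (2 * ε)) + 1 := by rw [mul_add, mul_inv_cancel₀ hμ0.ne']
      _ ≤ 1 * (L * (2 * ε)) + 1 := by gcongr
      _ ≤ _ := by linarith
  have key : ∀ n, (∀ t, |t| < ε → HasDerivAt (W n) (u n t) t) ∧
      ∀ s t, |s| < ε → |t| < ε → ‖u n s - u n t‖ ≤ M * |s - t| := by
    intro n
    induction n with
    | zero =>
      refine ⟨fun t _ => ?_, fun s t _ _ => ?_⟩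
      · simpa [W, u] using (hasDerivAt_id t).smul_const v
      · simpa [u] using by positivity
    | succ n ih =>
      obtain ⟨ihd, ihL⟩ := ih
      have hb := hu2 n ihL
      have hWb : ∀ t, |t| < ε → ‖W n t‖ ≤ 2 * |t| := fun t ht =>
        norm_le_of_hasDerivAt_of_zero (hW0 n) ht ihd fun s hs => hb s (hs.trans_lt ht)
      have hWρ : ∀ t, |t| < ε → ‖W n t‖ < ρ := fun t ht => by linarith [hWb t ht]
      refine ⟨fun t ht => ?_, fun s t hs ht => ?_⟩
      · have h1 := (hGd _ (hWρ _ (hμt ht))).comp_hasDerivAt t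
          ((ihd _ (hμt ht)).scomp t ((hasDerivAt_id t).const_mul μ))
        refine h1.congr_deriv ?_
        simp [hus]
      · have hWL : ‖W n (μ * s) - W n (μ * t)‖ ≤ 2 * |μ * s - μ * t| := by
          have := (convex_ball (0 : ℝ) ε).norm_image_sub_le_of_norm_hasDerivWithin_le
            (f := W n) (f' := u n) (C := 2) (x := μ * t) (y := μ * s)
            (fun r hr => (ihd r (by simpa using hr)).hasDerivWithinAt)
            (fun r hr => hb r (by simpa using hr)) (by simpa using hμt ht) (by simpa using hμt hs)
          simpa using this
        have e1 := hL _ _ (hWρ _ (hμt hs)) (hWρ _ (hμt ht))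
        have e2 := ihL _ _ (hμt hs) (hμt ht)
        have e3 := hDG (W n (μ * t)) (by linarith [hWb _ (hμt ht), hμt ht]) (hWρ _ (hμt ht))
        rw [← mul_sub, abs_mul, abs_of_pos hμ0] at hWL e2
        have e4 : ‖μ • (fderiv ℝ G (W n (μ * s)) - fderiv ℝ G (W n (μ * t)))‖ ≤
            L * (2 * |s - t|) := by
          rw [norm_smul, Real.norm_of_nonneg hμ0.le]
          have : L * ‖W n (μ * s) - W n (μ * t)‖ ≤ L * (2 * |s - t|) := by
            gcongr
            refine hWL.trans ?_
            gcongr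
            exact mul_le_of_le_one_left (abs_nonneg _) hμ1.le
          refine (mul_le_of_le_one_left (norm_nonneg _) hμ1.le).trans (e1.trans this)
        have := (norm_sub_le_of_eq (b₁ := (0 : E)) (b₂ := 0)
          (w₁ := u n (μ * s)) (w₂ := u n (μ * t))
          (C₁ := μ • fderiv ℝ G (W n (μ * s))) (C₂ := μ • fderiv ℝ G (W n (μ * t))))
        simp only [zero_add, sub_zero, norm_zero, ← smul_sub] at this
        simp only [hus]
        refine this.trans ?_
        calc _ ≤ L * (2 * |s - t|) * 2 + (1 + (1 - μ) / 4) * (M * (μ * |s - t|)) := by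
              gcongr
              exact hb _ (hμt hs)
          _ = |s - t| * (4 * L + (1 + (1 - μ) / 4) * μ * M) := by ring
          _ ≤ |s - t| * M := by
              gcongr
              nlinarith
          _ = _ := mul_comm _ _
  have hb := fun n => hu2 n (key n).2
  have hWb : ∀ n t, |t| < ε → ‖W n t‖ ≤ 2 * |t| := fun n t ht =>
    norm_le_of_hasDerivAt_of_zero (hW0 n) ht (key n).1 fun s hs => hb n s (hs.trans_lt ht)
  have hWρ : ∀ n t, |t| < ε → ‖W n t‖ < ρ := fun n t ht => by linarith [hWb n t ht]
  set κ := (1 + μ) / 2 with hκ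
  have hκ0 : 0 < κ := by positivity
  have hκ1 : κ < 1 := by linarith
  have hWdiff : ∀ n c t, |t| < ε → (∀ t, |t| < ε → ‖u (n + 1) t - u n t‖ ≤ c * |t|) → 0 ≤ c →
      ‖W (n + 1) t - W n t‖ ≤ c * |t| * |t| := by
    intro n c t ht hc hc0
    refine norm_le_of_hasDerivAt_of_zero (W := fun t => W (n + 1) t - W n t)
      (by simp [hW0]) ht (fun s hs => ((key (n + 1)).1 s hs).sub ((key n).1 s hs)) fun s hs => ?_
    refine (hc s (hs.trans_lt ht)).trans ?_
    gcongr
  have hcauchy : ∀ n t, |t| < ε → ‖u (n + 1) t - u n t‖ ≤ 2 * M * κ ^ n * |t| := by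
    intro n
    induction n with
    | zero =>
      intro t ht
      have h1 := (key 1).2 t 0 ht (by simpa)
      rw [hu0, sub_zero] at h1
      have : u 0 t = v := rfl
      rw [zero_add, this]
      nlinarith [abs_nonneg t]
    | succ n ih =>
      intro t ht
      have hW := hWdiff n _ _ (hμt ht) ih (by positivity)
      have e1 := hL _ _ (hWρ (n + 1) _ (hμt ht)) (hWρ n _ (hμt ht))
      have e2 := ih _ (hμt ht)
      have e3 := hDG (W n (μ * t)) (by linarith [hWb n _ (hμt ht), hμt ht]) (hWρ n _ (hμt ht))
      have e4 : ‖μ • (fderiv ℝ G (W (n + 1) (μ * t)) - fderiv ℝ G (W n (μ * t)))‖ ≤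
          L * (2 * M * κ ^ n * |t| * ε) := by
        rw [norm_smul, Real.norm_of_nonneg hμ0.le]
        have : L * ‖W (n + 1) (μ * t) - W n (μ * t)‖ ≤ L * (2 * M * κ ^ n * |t| * ε) := by
          gcongr
          exact hW.trans (mul_le_mul (mul_le_mul_of_nonneg_left (hμle t) (by positivity))
            (hμt ht).le (abs_nonneg _) (by positivity))
        refine (mul_le_of_le_one_left (norm_nonneg _) hμ1.le).trans (e1.trans this)
      have := (norm_sub_le_of_eq (b₁ := (0 : E)) (b₂ := 0)
        (w₁ := u (n + 1) (μ * t)) (w₂ := u n (μ * t))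
        (C₁ := μ • fderiv ℝ G (W (n + 1) (μ * t))) (C₂ := μ • fderiv ℝ G (W n (μ * t))))
      simp only [zero_add, sub_zero, norm_zero, ← smul_sub] at this
      rw [hus (n + 1), hus n]
      refine this.trans ?_
      rw [abs_mul, abs_of_pos hμ0] at e2
      calc _ ≤ L * (2 * M * κ ^ n * |t| * ε) * 2 +
            (1 + (1 - μ) / 4) * (2 * M * κ ^ n * (μ * |t|)) := by
              gcongr
              exact hb (n + 1) _ (hμt ht)
        _ = 2 * M * κ ^ n * |t| * (2 * L * ε + (1 + (1 - μ) / 4) * μ) := by ring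
        _ ≤ 2 * M * κ ^ n * |t| * κ := by
              gcongr
              nlinarith
        _ = _ := by ring
  have hcu : ∀ t, |t| < ε → ∀ n, dist (u n t) (u (n + 1) t) ≤ 2 * M * ε * κ ^ n := by
    intro t ht n
    rw [dist_comm, dist_eq_norm]
    refine (hcauchy n t ht).trans ?_
    calc _ ≤ 2 * M * κ ^ n * ε := by gcongr
      _ = _ := by ring
  have hcW : ∀ t, |t| < ε → ∀ n, dist (W n t) (W (n + 1) t) ≤ 2 * M * ε * ε * κ ^ n := by
    intro t ht n
    rw [dist_comm, dist_eq_norm]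
    refine (hWdiff n _ t ht (hcauchy n) (by positivity)).trans ?_
    calc _ ≤ 2 * M * κ ^ n * ε * ε := by gcongr
      _ = _ := by ring
  have hexu : ∀ t, ∃ l, |t| < ε → Tendsto (fun n => u n t) atTop (𝓝 l) := fun t => by
    by_cases ht : |t| < ε
    · obtain ⟨l, hl⟩ := cauchySeq_tendsto_of_complete (cauchySeq_of_le_geometric _ _ hκ1 (hcu t ht))
      exact ⟨l, fun _ => hl⟩
    · exact ⟨0, fun h => absurd h ht⟩
  have hexW : ∀ t, ∃ l, |t| < ε → Tendsto (fun n => W n t) atTop (𝓝 l) := fun t => by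
    by_cases ht : |t| < ε
    · obtain ⟨l, hl⟩ := cauchySeq_tendsto_of_complete (cauchySeq_of_le_geometric _ _ hκ1 (hcW t ht))
      exact ⟨l, fun _ => hl⟩
    · exact ⟨0, fun h => absurd h ht⟩
  choose u' hu' using hexu
  choose W' hW' using hexW
  have hunif : TendstoUniformlyOn u u' atTop (Metric.ball 0 ε) := by
    rw [Metric.tendstoUniformlyOn_iff]
    intro η hη
    have hlim : Tendsto (fun n => 2 * M * ε * κ ^ n / (1 - κ)) atTop
        (𝓝 (2 * M * ε * 0 / (1 - κ))) :=
      ((tendsto_pow_atTop_nhds_zero_of_lt_one hκ0.le hκ1).const_mul _).div_const _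
    rw [mul_zero, zero_div] at hlim
    filter_upwards [hlim.eventually_lt_const hη] with n hn t ht
    have ht' : |t| < ε := by simpa using ht
    rw [dist_comm]
    exact (dist_le_of_le_geometric_of_tendsto _ _ hκ1 (hcu t ht') (hu' t ht') n).trans_lt hn
  refine ⟨W', u', ?_, ?_, ?_, ?_, ?_⟩
  · refine tendsto_nhds_unique (hW' 0 (by simpa)) ?_
    simp [hW0]
  · refine tendsto_nhds_unique (hu' 0 (by simpa)) ?_
    simp [hu0]
  · filter_upwards [Metric.ball_mem_nhds (0 : ℝ) hε0] with t ht
    exact hasDerivAt_of_tendstoUniformlyOn Metric.isOpen_ball hunif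
      (.of_forall fun n s hs => (key n).1 s (by simpa using hs))
      (fun s hs => hW' s (by simpa using hs)) ht
  · refine HolderNear.of_ball (C := M) hε0 fun s hs t ht => ?_
    rw [mem_ball_zero_iff, Real.norm_eq_abs] at hs ht
    rw [Real.rpow_one]
    exact le_of_tendsto ((hu' s hs).sub (hu' t ht)).norm (.of_forall fun n => (key n).2 s t hs ht)
  · refine eventually_nhds_zero_iff.2 ⟨ε, hε0, fun t ht => ?_⟩
    have h1 := hW' _ (hμt ht)
    have h2 : ‖W' (μ * t)‖ < ρ := by
      have := le_of_tendsto h1.norm (.of_forall fun n => hWb n _ (hμt ht))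
      linarith [hμt ht]
    have h3 := (hGd _ h2).continuousAt.tendsto.comp h1
    exact tendsto_nhds_unique ((tendsto_add_atTop_iff_nat 1).2 (hW' t ht)) h3

/-- A `C^{n,γ}` map has a `C^{n,γ}` invariant curve, on which it acts linearly, along any
eigenvector of its derivative whose eigenvalue `μ⁻¹ > 1` bounds the norm of the derivative. -/
lemma exists_cHolderAt_invariant_curve [CompleteSpace E] (hμ0 : 0 < μ) (hμ1 : μ < 1) {γ : ℝ}
    (hγ : 0 ≤ γ) (hγ1 : γ ≤ 1) {k : ℕ} {G : E → E}
    (hG : CHolderAt (k + 2) γ G 0) (hG0 : G 0 = 0) {v : E} (hv : ‖v‖ ≤ 1)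
    (hA : ‖fderiv ℝ G 0‖ ≤ μ⁻¹) (hAv : fderiv ℝ G 0 v = μ⁻¹ • v) :
    ∃ W : ℝ → E, W 0 = 0 ∧ HasDerivAt W v 0 ∧ CHolderAt (k + 2) γ W 0 ∧
      ∀ᶠ t in 𝓝 0, W t = G (W (μ * t)) := by
  obtain ⟨W, u, hW0, hu0, hd, hL, hW⟩ := exists_invariant_curve hμ0 hμ1
    (hG.1.of_le (by norm_cast; omega)) hG0 hv hA hAv
  have hWu : ∀ m, CHolderAt m γ u 0 → CHolderAt (m + 1) γ W 0 := fun m hm =>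
    (cHolderAt_succ_iff_deriv hγ1).2 ⟨hd.mono fun t ht => ht.differentiableAt,
      hm.congr (hd.mono fun t ht => ht.deriv.symm)⟩
  have hd0 := hd.self_of_nhds
  have hG1 := cHolderAt_succ_iff.1 hG
  have hWc : Tendsto W (𝓝 0) (𝓝 0) := by simpa [hW0] using hd0.continuousAt.tendsto
  have hμ := tendsto_const_mul_nhds_zero μ
  have hu : ∀ᶠ t in 𝓝 0, u t = (μ • fderiv ℝ G (W (μ * t))) (u (μ * t)) := by
    filter_upwards [hW.eventually_nhds, hd, hμ.eventually hd,
      (hWc.comp hμ).eventually hG1.1] with t h1 h2 h3 h4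
    have h5 := h4.hasFDerivAt.comp_hasDerivAt t (h3.scomp t ((hasDerivAt_id t).const_mul μ))
    refine (h2.unique (h5.congr_of_eventuallyEq h1)).trans ?_
    simp
  have hreg : ∀ m ≤ k + 1, CHolderAt m γ u 0 := by
    intro m
    induction m with
    | zero =>
      intro _
      refine cHolderAt_zero_iff.2 ⟨?_, hL.of_one hγ1⟩
      obtain ⟨K, hK, δ, hδ, h⟩ := hL.exists_ball
      filter_upwards [Metric.ball_mem_nhds (0 : ℝ) hδ] with t ht
      have : LipschitzOnWith K.toNNReal u (Metric.ball 0 δ) :=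
        LipschitzOnWith.of_dist_le_mul fun s hs t ht => by
          simpa [dist_eq_norm, hK.le] using h s hs t ht
      exact this.continuousOn.continuousAt (Metric.isOpen_ball.mem_nhds ht)
    | succ m ih =>
      intro hm
      have hum := ih (by omega)
      refine CHolderAt.succ_of_eq_clm hμ0 hμ1 hγ hγ1 hu hL ?_ ?_ hum
      · simp only [mul_zero, hW0, norm_smul, Real.norm_of_nonneg hμ0.le]
        have : μ * ‖fderiv ℝ G 0‖ ≤ 1 := by
          calc _ ≤ μ * μ⁻¹ := by gcongr
            _ = 1 := mul_inv_cancel₀ hμ0.ne'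
        nlinarith
      · have h1 := (hWu m hum).comp_const_mul hγ hγ1 μ
        have h2 := CHolderAt.comp' hγ hγ1 (g := fderiv ℝ G) (f := fun t => W (μ * t)) (x := 0)
          (by simpa [hW0] using hG1.2.of_le hm hγ1) h1
        exact h2.clm_comp hγ1 (μ • ContinuousLinearMap.id ℝ (E →L[ℝ] E))
  exact ⟨W, hW0, hu0 ▸ hd0, hWu _ (hreg _ le_rfl), hW⟩

end InvariantCurve

section LocalInverse

lemma cHolderAt_localInverse {E : Type} [NormedAddCommGroup E] [NormedSpace ℝ E]
    [CompleteSpace E] {γ : ℝ} (hγ : 0 ≤ γ) (hγ1 : γ ≤ 1) {k : ℕ} {G : E → E} {A : E ≃L[ℝ] E}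
    (hG : CHolderAt (k + 2) γ G 0) (hG0 : G 0 = 0) (hA : HasFDerivAt G (A : E →L[ℝ] E) 0) :
    ∃ H : E → E, H 0 = 0 ∧ HasFDerivAt H (A.symm : E →L[ℝ] E) 0 ∧ CHolderAt (k + 2) γ H 0 ∧
      (∀ᶠ x in 𝓝 0, H (G x) = x) ∧ ∀ᶠ y in 𝓝 0, G (H y) = y := by
  have hn : ((k + 2 : ℕ) : WithTop ℕ∞) ≠ 0 := by simp
  have hn' : ((k + 2 : ℕ) : WithTop ℕ∞) ≠ ((⊤ : ℕ∞) : WithTop ℕ∞) := by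
    generalize k + 2 = n
    simp
  have hs : HasStrictFDerivAt G (A : E →L[ℝ] E) 0 := hG.1.hasStrictFDerivAt' hA hn
  set H := hs.localInverse G A 0
  have hH0 : H 0 = 0 := by
    have := hs.eventually_left_inverse.self_of_nhds
    rwa [hG0] at this
  have hHd : HasStrictFDerivAt H (A.symm : E →L[ℝ] E) 0 := by
    have := hs.to_localInverse
    rwa [hG0] at this
  have hHc : ContDiffAt ℝ (k + 2 : ℕ) H 0 := by
    have := hG.1.to_localInverse hA hn
    rwa [hG0] at this
  have hr : ∀ᶠ y in 𝓝 0, G (H y) = y := by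
    have := hs.eventually_right_inverse
    rwa [hG0] at this
  have ht : Tendsto H (𝓝 0) (𝓝 0) := by simpa [hH0] using hHd.continuousAt.tendsto
  refine ⟨H, hH0, hHd.hasFDerivAt, ?_, hs.eventually_left_inverse, hr⟩
  have hG1 := cHolderAt_succ_iff.1 hG
  refine cHolderAt_succ_iff.2 ⟨(hHc.eventually hn').mono fun y hy =>
    hy.differentiableAt (by simp), ?_⟩
  have h1 : CHolderAt (k + 1) γ (fun y => fderiv ℝ G (H y)) 0 :=
    CHolderAt.comp' hγ hγ1 (by rw [hH0]; exact hG1.2) (hHc.cHolderAt (by norm_cast) hγ1)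
  have h2 : CHolderAt (k + 1) γ (fun y => (fderiv ℝ G (H y)).inverse) 0 := by
    refine CHolderAt.comp' hγ hγ1 (g := ContinuousLinearMap.inverse) ?_ h1
    rw [hH0, hA.fderiv]
    exact (contDiffAt_map_inverse (n := (k + 1 : ℕ) + 1) A).cHolderAt le_rfl hγ1
  have hinv : ∀ᶠ y in 𝓝 0, ∃ e : E ≃L[ℝ] E, (e : E →L[ℝ] E) = fderiv ℝ G (H y) := by
    have hc : Tendsto (fun y => fderiv ℝ G (H y)) (𝓝 0) (𝓝 (A : E →L[ℝ] E)) := by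
      simpa [hH0, hA.fderiv] using h1.continuousAt.tendsto
    exact hc.eventually (ContinuousLinearEquiv.nhds A)
  refine h2.congr ?_
  filter_upwards [hinv, hr.eventually_nhds, ht.eventually hG1.1,
    (hHc.eventually hn').mono fun y hy => hy.differentiableAt (by simp)]
    with y ⟨e, he⟩ h3 h4 h5
  have h6 : (fderiv ℝ G (H y)).comp (fderiv ℝ H y) = ContinuousLinearMap.id ℝ E :=
    (h4.hasFDerivAt.comp y h5.hasFDerivAt).unique
      ((hasFDerivAt_id y).congr_of_eventuallyEq h3)
  rw [← he] at h6 ⊢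
  rw [ContinuousLinearMap.inverse_equiv]
  ext z
  have := congrArg (fun L : E →L[ℝ] E => L z) h6
  simp only [ContinuousLinearMap.comp_apply, ContinuousLinearMap.id_apply] at this
  exact (e.symm_apply_eq.2 this.symm)

end LocalInverse

section Hadamard

lemma fderiv_fderiv_comp {D E F : Type*} [NormedAddCommGroup D] [NormedSpace ℝ D]
    [NormedAddCommGroup E] [NormedSpace ℝ E] [NormedAddCommGroup F] [NormedSpace ℝ F]
    {g : E → F} {f : D → E} {a : D} (hg : ContDiffAt ℝ 2 g (f a)) (hf : ContDiffAt ℝ 2 f a)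
    (v w : D) :
    fderiv ℝ (fderiv ℝ fun z => g (f z)) a v w =
      fderiv ℝ (fderiv ℝ g) (f a) (fderiv ℝ f a v) (fderiv ℝ f a w) +
        fderiv ℝ g (f a) (fderiv ℝ (fderiv ℝ f) a v w) := by
  have hg1 := ((hg.fderiv_right (m := 1) (by norm_num)).differentiableAt (by simp)).hasFDerivAt
  have hf1 := ((hf.fderiv_right (m := 1) (by norm_num)).differentiableAt (by simp)).hasFDerivAt
  have hfa := (hf.differentiableAt (by simp)).hasFDerivAt
  have h : fderiv ℝ (fun z => g (f z)) =ᶠ[𝓝 a] fun z => (fderiv ℝ g (f z)).comp (fderiv ℝ f z) := by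
    filter_upwards [hf.eventually (by simp),
      hf.continuousAt.eventually (hg.eventually (by simp))] with z h1 h2
    exact fderiv_comp z (h2.differentiableAt (by simp)) (h1.differentiableAt (by simp))
  have h' : HasFDerivAt (fun z => (fderiv ℝ g (f z)).comp (fderiv ℝ f z)) _ a :=
    (hg1.comp a hfa).clm_comp hf1
  rw [h.fderiv_eq, h'.fderiv]
  simp [add_comm]

/-- Averaging a Hölder function over a path of contractions keeps the Hölder bound. -/
lemma norm_integral_comp_sub_le {D E : Type*} [NormedAddCommGroup D]
    [NormedAddCommGroup E] [NormedSpace ℝ E] {h : D → E} {T : ℝ → D → D} {C γ δ : ℝ}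
    (hγ : 0 ≤ γ) (hC : 0 ≤ C) (hc : ContinuousOn h (Metric.ball 0 δ))
    (hh : ∀ y ∈ Metric.ball 0 δ, ∀ z ∈ Metric.ball 0 δ, ‖h y - h z‖ ≤ C * ‖y - z‖ ^ γ)
    (hT : ∀ s ∈ Icc (0 : ℝ) 1, ∀ y z, ‖T s y - T s z‖ ≤ ‖y - z‖) (hT0 : ∀ s, T s 0 = 0)
    (hTc : ∀ z, Continuous fun s => T s z) :
    ∀ y ∈ Metric.ball 0 δ, ∀ z ∈ Metric.ball 0 δ,
      ‖(∫ s in (0 : ℝ)..1, h (T s y)) - ∫ s in (0 : ℝ)..1, h (T s z)‖ ≤ C * ‖y - z‖ ^ γ := by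
  intro y hy z hz
  have hmem : ∀ y ∈ Metric.ball 0 δ, ∀ s ∈ Icc (0 : ℝ) 1, T s y ∈ Metric.ball 0 δ := by
    intro y hy s hs
    have := hT s hs y 0
    rw [hT0, sub_zero, sub_zero] at this
    rw [mem_ball_zero_iff] at *
    linarith
  have hint : ∀ y ∈ Metric.ball 0 δ, IntervalIntegrable (fun s => h (T s y)) volume 0 1 := by
    intro y hy
    refine ContinuousOn.intervalIntegrable ?_
    rw [uIcc_of_le zero_le_one]
    exact hc.comp (hTc y).continuousOn (hmem y hy)
  rw [← intervalIntegral.integral_sub (hint y hy) (hint z hz)]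
  refine (intervalIntegral.norm_integral_le_of_norm_le_const (C := C * ‖y - z‖ ^ γ) ?_).trans ?_
  · intro s hs
    rw [uIoc_of_le zero_le_one] at hs
    have hs' : s ∈ Icc (0 : ℝ) 1 := ⟨hs.1.le, hs.2⟩
    refine (hh _ (hmem y hy s hs') _ (hmem z hz s hs')).trans ?_
    gcongr
    exact hT s hs' y z
  · simp

/-- **Hadamard's lemma.** A `C^{2,γ}` map vanishing on both axes is `xy` times a `γ`-Hölder map. -/
lemma exists_eq_mul_smul_of_vanish_axes {E : Type} [NormedAddCommGroup E] [NormedSpace ℝ E]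
    [CompleteSpace E] {γ : ℝ} (hγ : 0 < γ) {f : ℝ × ℝ → E} (hf : CHolderAt 2 γ f 0)
    (hx : ∀ᶠ x : ℝ in 𝓝 0, f (x, 0) = 0) (hy : ∀ᶠ y : ℝ in 𝓝 0, f (0, y) = 0) :
    ∃ φ : ℝ × ℝ → E, φ 0 = fderiv ℝ (fderiv ℝ f) 0 (1, 0) (0, 1) ∧ HolderNear γ φ 0 ∧
      ∀ᶠ z : ℝ × ℝ in 𝓝 0, f z = (z.1 * z.2) • φ z := by
  set g : ℝ × ℝ → E := fun z => fderiv ℝ f z (0, 1)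
  set h : ℝ × ℝ → E := fun z => fderiv ℝ (fderiv ℝ f) z (1, 0) (0, 1)
  obtain ⟨hfd, hf1⟩ := cHolderAt_succ_iff.1 hf
  obtain ⟨hgd, hf2⟩ := cHolderAt_succ_iff.1 hf1
  obtain ⟨hhc, hhH⟩ := cHolderAt_zero_iff.1 hf2
  obtain ⟨C, hC, δ₁, hδ₁, hH⟩ := hhH.exists_ball
  have hg0 : ∀ᶠ y : ℝ in 𝓝 0, g (0, y) = 0 := by
    have ht : Tendsto (fun y : ℝ => ((0 : ℝ), y)) (𝓝 0) (𝓝 0) :=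
      (Continuous.prodMk_right (0 : ℝ)).tendsto' _ _ rfl
    filter_upwards [hy.eventually_nhds, ht.eventually hfd] with y h1 h2
    have h3 := h2.hasFDerivAt.comp_hasDerivAt y
      ((hasDerivAt_const y (0 : ℝ)).prodMk (hasDerivAt_id y))
    exact h3.unique ((hasDerivAt_const y (0 : E)).congr_of_eventuallyEq h1)
  obtain ⟨δ₂, hδ₂, hB⟩ := Metric.eventually_nhds_iff_ball.1 (hfd.and (hgd.and hhc))
  obtain ⟨δ₃, hδ₃, hX⟩ := eventually_nhds_zero_iff.1 (hx.and hg0)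
  set δ := min δ₁ (min δ₂ δ₃)
  have hδ : 0 < δ := by positivity
  replace hB : ∀ z ∈ Metric.ball (0 : ℝ × ℝ) δ, _ := fun z hz =>
    hB z (Metric.ball_subset_ball ((min_le_right _ _).trans (min_le_left _ _)) hz)
  replace hX : ∀ x : ℝ, |x| < δ → _ := fun x hx =>
    hX x (hx.trans_le ((min_le_right _ _).trans (min_le_right _ _)))
  have hhC : ∀ y ∈ Metric.ball (0 : ℝ × ℝ) δ, ∀ z ∈ Metric.ball (0 : ℝ × ℝ) δ,
      ‖h y - h z‖ ≤ C * ‖y - z‖ ^ γ := by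
    intro y hy z hz
    refine le_trans ?_ (hH y (Metric.ball_subset_ball (min_le_left _ _) hy) z
      (Metric.ball_subset_ball (min_le_left _ _) hz))
    have e1 : ‖((1 : ℝ), (0 : ℝ))‖ = 1 := by simp
    have e2 : ‖((0 : ℝ), (1 : ℝ))‖ = 1 := by simp
    have := (fderiv ℝ (fderiv ℝ f) y - fderiv ℝ (fderiv ℝ f) z).le_opNorm₂ (1, 0) (0, 1)
    rw [e1, e2, mul_one, mul_one] at this
    simpa [h] using this
  have hhcont : ContinuousOn h (Metric.ball 0 δ) := fun z hz =>
    (((hB z hz).2.2.clm_apply continuousAt_const).clm_apply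
      continuousAt_const).continuousWithinAt
  have hmul : ∀ {s a : ℝ}, s ∈ Icc (0 : ℝ) 1 → |s * a| ≤ |a| := fun {s a} hs => by
    rw [abs_mul, abs_of_nonneg hs.1]
    exact mul_le_of_le_one_left (abs_nonneg _) hs.2
  have hball : ∀ z : ℝ × ℝ, z ∈ Metric.ball (0 : ℝ × ℝ) δ ↔ |z.1| < δ ∧ |z.2| < δ := fun z => by
    simp [Prod.norm_def]
  set ψ : ℝ × ℝ → E := fun z => ∫ s in (0 : ℝ)..1, h (s * z.1, z.2)
  set φ : ℝ × ℝ → E := fun z => ∫ s in (0 : ℝ)..1, ψ (z.1, s * z.2)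
  have hψC := norm_integral_comp_sub_le (T := fun s z => (s * z.1, z.2)) hγ.le hC.le hhcont hhC
    (fun s hs y z => by
      simp only [Prod.norm_def, Prod.fst_sub, Prod.snd_sub, ← mul_sub, Real.norm_eq_abs]
      exact max_le_max (hmul hs) le_rfl)
    (fun s => by simp) (fun z => by fun_prop)
  have hψcont : ContinuousOn ψ (Metric.ball 0 δ) := by
    intro z hz
    rw [ContinuousWithinAt, tendsto_iff_norm_sub_tendsto_zero]
    have hlim : Tendsto (fun y : ℝ × ℝ => C * ‖y - z‖ ^ γ) (𝓝[Metric.ball 0 δ] z)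
        (𝓝 (C * ‖z - z‖ ^ γ)) :=
      (((continuous_id.sub continuous_const).norm.rpow_const fun _ => .inr hγ.le).const_mul
        C).continuousWithinAt.tendsto
    rw [sub_self, norm_zero, Real.zero_rpow hγ.ne', mul_zero] at hlim
    refine squeeze_zero' (.of_forall fun _ => norm_nonneg _) ?_ hlim
    filter_upwards [self_mem_nhdsWithin] with y hy using hψC y hy z hz
  have hφC := norm_integral_comp_sub_le (T := fun s z => (z.1, s * z.2)) hγ.le hC.le hψcont hψC
    (fun s hs y z => by
      simp only [Prod.norm_def, Prod.fst_sub, Prod.snd_sub, ← mul_sub, Real.norm_eq_abs]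
      exact max_le_max le_rfl (hmul hs))
    (fun s => by simp) (fun z => by fun_prop)
  have hgψ : ∀ z ∈ Metric.ball (0 : ℝ × ℝ) δ, g z = z.1 • ψ z := by
    intro z hz
    have hm : ∀ s ∈ Icc (0 : ℝ) 1, (s * z.1, z.2) ∈ Metric.ball (0 : ℝ × ℝ) δ := fun s hs => by
      rw [hball] at *
      exact ⟨(hmul hs).trans_lt hz.1, hz.2⟩
    have key := intervalIntegral.integral_eq_sub_of_hasDerivAt
      (f := fun s => g (s * z.1, z.2)) (f' := fun s => z.1 • h (s * z.1, z.2)) (a := 0) (b := 1)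
      (fun s hs => by
        rw [uIcc_of_le zero_le_one] at hs
        have h1 := (hB _ (hm s hs)).2.1.hasFDerivAt.comp_hasDerivAt s
          (((hasDerivAt_id s).mul_const z.1).prodMk (hasDerivAt_const s z.2))
        have h2 := h1.clm_apply (hasDerivAt_const s ((0 : ℝ), (1 : ℝ)))
        refine h2.congr_deriv ?_
        have : ((1 : ℝ) * z.1, (0 : ℝ)) = z.1 • ((1 : ℝ), (0 : ℝ)) := by simp
        simp only [this, map_smul]
        simp [h])
      (by
        refine ContinuousOn.intervalIntegrable ?_
        rw [uIcc_of_le zero_le_one]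
        exact (hhcont.comp (f := fun s : ℝ => (s * z.1, z.2)) (by fun_prop) hm).const_smul _)
    rw [intervalIntegral.integral_smul] at key
    have hz2 := (hX z.2 ((hball z).1 hz).2).2
    simpa [hz2] using key.symm
  have hfφ : ∀ z ∈ Metric.ball (0 : ℝ × ℝ) δ, f z = (z.1 * z.2) • φ z := by
    intro z hz
    have hm : ∀ s ∈ Icc (0 : ℝ) 1, (z.1, s * z.2) ∈ Metric.ball (0 : ℝ × ℝ) δ := fun s hs => by
      rw [hball] at *
      exact ⟨hz.1, (hmul hs).trans_lt hz.2⟩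
    have key := intervalIntegral.integral_eq_sub_of_hasDerivAt
      (f := fun s => f (z.1, s * z.2)) (f' := fun s => (z.1 * z.2) • ψ (z.1, s * z.2))
      (a := 0) (b := 1)
      (fun s hs => by
        rw [uIcc_of_le zero_le_one] at hs
        have h1 := (hB _ (hm s hs)).1.hasFDerivAt.comp_hasDerivAt s
          ((hasDerivAt_const s z.1).prodMk ((hasDerivAt_id s).mul_const z.2))
        refine h1.congr_deriv ?_
        have : ((0 : ℝ), (1 : ℝ) * z.2) = z.2 • ((0 : ℝ), (1 : ℝ)) := by simp
        rw [this, map_smul, mul_comm z.1, mul_smul]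
        exact congrArg (z.2 • ·) (hgψ _ (hm s hs)))
      (by
        refine ContinuousOn.intervalIntegrable ?_
        rw [uIcc_of_le zero_le_one]
        exact (hψcont.comp (f := fun s : ℝ => (z.1, s * z.2)) (by fun_prop) hm).const_smul _)
    rw [intervalIntegral.integral_smul] at key
    have hz1 := (hX z.1 ((hball z).1 hz).1).1
    simpa [hz1] using key.symm
  refine ⟨φ, by simp [φ, ψ, h]; rfl, HolderNear.of_ball hδ hφC, ?_⟩
  filter_upwards [Metric.ball_mem_nhds (0 : ℝ × ℝ) hδ] using hfφ

end Hadamard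

section NormalForm

/-- The diagonal linear automorphism `(x, y) ↦ (ax, by)` of the plane. -/
def diagEquiv (a b : ℝ) (ha : a ≠ 0) (hb : b ≠ 0) : (ℝ × ℝ) ≃L[ℝ] (ℝ × ℝ) :=
  ContinuousLinearEquiv.equivOfInverse
    ((a • ContinuousLinearMap.fst ℝ ℝ ℝ).prod (b • ContinuousLinearMap.snd ℝ ℝ ℝ))
    ((a⁻¹ • ContinuousLinearMap.fst ℝ ℝ ℝ).prod (b⁻¹ • ContinuousLinearMap.snd ℝ ℝ ℝ))
    (fun z => by ext <;> simp [ha, hb]) (fun z => by ext <;> simp [ha, hb])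

@[simp] lemma diagEquiv_apply {a b : ℝ} (ha : a ≠ 0) (hb : b ≠ 0) (z : ℝ × ℝ) :
    diagEquiv a b ha hb z = (a * z.1, b * z.2) := rfl

@[simp] lemma diagEquiv_symm_apply {a b : ℝ} (ha : a ≠ 0) (hb : b ≠ 0) (z : ℝ × ℝ) :
    (diagEquiv a b ha hb).symm z = (a⁻¹ * z.1, b⁻¹ * z.2) := rfl

lemma norm_clm_le_of_abs_le {L : ℝ × ℝ →L[ℝ] ℝ × ℝ} {a b c : ℝ} (hc : 0 ≤ c)
    (hL : ∀ z, L z = (a * z.1, b * z.2)) (ha : |a| ≤ c) (hb : |b| ≤ c) : ‖L‖ ≤ c := by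
  refine L.opNorm_le_bound hc fun z => ?_
  rw [hL, Prod.norm_def, Prod.norm_def, Real.norm_eq_abs, Real.norm_eq_abs, abs_mul, abs_mul]
  refine max_le ?_ ?_ <;> gcongr
  · exact le_max_left _ _
  · exact le_max_right _ _

lemma CHolderAt.two_of_lt_or_eq {E F : Type} [NormedAddCommGroup E] [NormedSpace ℝ E]
    [NormedAddCommGroup F] [NormedSpace ℝ F] {k : ℕ} {γ θ : ℝ} (hθ1 : θ ≤ 1)
    (hk : 0 < k ∨ k = 0 ∧ θ = γ) {f : E → F} {x : E} (hf : CHolderAt (k + 2) γ f x) :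
    CHolderAt 2 θ f x := by
  rcases hk with hk | ⟨rfl, rfl⟩
  · exact hf.of_lt (by omega) hθ1
  · exact hf

lemma fderiv_fderiv_apply_of_eventually_eq {E : Type*} [NormedAddCommGroup E] [NormedSpace ℝ E]
    {f : ℝ × ℝ → E} {c u : E} (hf : DifferentiableAt ℝ (fderiv ℝ f) 0)
    (h : ∀ᶠ x : ℝ in 𝓝 0, fderiv ℝ f (x, 0) (0, 1) = c + x • u) :
    fderiv ℝ (fderiv ℝ f) 0 (1, 0) (0, 1) = u := by
  have h1 := (HasFDerivAt.comp_hasDerivAt (0 : ℝ) (l := fderiv ℝ f) (l' := fderiv ℝ (fderiv ℝ f) 0)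
    (f := fun x : ℝ => (x, (0 : ℝ))) hf.hasFDerivAt
    ((hasDerivAt_id (0 : ℝ)).prodMk (hasDerivAt_const (0 : ℝ) (0 : ℝ)))).clm_apply
    (hasDerivAt_const (0 : ℝ) ((0 : ℝ), (1 : ℝ)))
  have h2 : HasDerivAt (fun x : ℝ => c + x • u) u 0 := by
    simpa using ((hasDerivAt_id (0 : ℝ)).smul_const u).const_add c
  have h3 := h1.unique (h2.congr_of_eventuallyEq h)
  simpa using h3

/-- Normal form for a germ whose linear part is already diagonal. -/
lemma exists_normal_form_of_diag {μ : ℝ} (hμ0 : 0 < μ) (hμ1 : μ < 1) {γ θ : ℝ} (hγ : 0 ≤ γ)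
    (hγ1 : γ ≤ 1) (hθ : 0 < θ) (hθ1 : θ ≤ 1) {k : ℕ} (hk : 0 < k ∨ k = 0 ∧ θ = γ)
    {G : ℝ × ℝ → ℝ × ℝ} (hG : CHolderAt (k + 2) γ G 0) (hG0 : G 0 = 0)
    (hA : HasFDerivAt G
      (diagEquiv μ μ⁻¹ hμ0.ne' (inv_ne_zero hμ0.ne') : ℝ × ℝ →L[ℝ] ℝ × ℝ) 0) :
    ∃ Ψ φ : ℝ × ℝ → ℝ × ℝ, Ψ 0 = 0 ∧
      HasFDerivAt Ψ (ContinuousLinearMap.id ℝ (ℝ × ℝ)) 0 ∧ CHolderAt (k + 2) γ Ψ 0 ∧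
      HolderNear θ φ 0 ∧ φ 0 = 0 ∧ ∀ᶠ z : ℝ × ℝ in 𝓝 0, G (Ψ z) =
        Ψ (μ * z.1 + z.1 * z.2 * (φ z).1, μ⁻¹ * z.2 + z.1 * z.2 * (φ z).2) := by
  set A := diagEquiv μ μ⁻¹ hμ0.ne' (inv_ne_zero hμ0.ne')
  have hμ' : 1 < μ⁻¹ := (one_lt_inv₀ hμ0).2 hμ1
  have habs : |μ| ≤ μ⁻¹ := by rw [abs_of_pos hμ0]; linarith
  have habs' : |μ⁻¹| ≤ μ⁻¹ := by rw [abs_of_pos (by positivity)]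
  have hinv0 : (0 : ℝ) ≤ μ⁻¹ := by positivity
  obtain ⟨H, hH0, hHA, hH, hHG, hGH⟩ := cHolderAt_localInverse hγ hγ1 hG hG0 hA
  obtain ⟨Wu, hWu0, hWud, hWu, hWuG⟩ := exists_cHolderAt_invariant_curve hμ0 hμ1 hγ hγ1 hG hG0
    (v := (0, 1)) (by simp) (by
      rw [hA.fderiv]
      exact norm_clm_le_of_abs_le hinv0 (fun z => rfl : ∀ z, A z = (μ * z.1, μ⁻¹ * z.2)) habs habs')
    (by rw [hA.fderiv]; simp [A])
  obtain ⟨Ws, hWs0, hWsd, hWs, hWsH⟩ := exists_cHolderAt_invariant_curve hμ0 hμ1 hγ hγ1 hH hH0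
    (v := (1, 0)) (by simp) (by
      rw [hHA.fderiv]
      exact norm_clm_le_of_abs_le hinv0
        (fun z => rfl : ∀ z, A.symm z = (μ⁻¹ * z.1, μ⁻¹⁻¹ * z.2)) habs'
        (by rwa [inv_inv]))
    (by rw [hHA.fderiv]; simp [A])
  set q := fderiv ℝ (fderiv ℝ G) 0 (1, 0) (0, 1)
  have hμsub : 1 - μ ≠ 0 := by linarith
  have hμinv_sub : 1 - μ⁻¹ ≠ 0 := by linarith
  set u : ℝ × ℝ := (q.1 / (1 - μ), q.2 / (1 - μ⁻¹))
  have hu : q + A u = u := by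
    ext
    · simp only [A, diagEquiv_apply, u, Prod.fst_add]
      field_simp
      ring
    · simp only [A, diagEquiv_apply, u, Prod.snd_add]
      have : q.2 = (1 - μ⁻¹) * (q.2 / (1 - μ⁻¹)) := by rw [mul_div_cancel₀ _ hμinv_sub]
      linear_combination this
  set Ψ : ℝ × ℝ → ℝ × ℝ := fun z => Ws z.1 + Wu z.2 + (z.1 * z.2) • u
  have hΨ0 : Ψ 0 = 0 := by simp [Ψ, hWs0, hWu0]
  have hΨx : ∀ x, Ψ (x, 0) = Ws x := fun x => by simp [Ψ, hWu0]
  have hΨy : ∀ y, Ψ (0, y) = Wu y := fun y => by simp [Ψ, hWs0]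
  have hΨ : CHolderAt (k + 2) γ Ψ 0 := by
    have e1 : CHolderAt (k + 2) γ (fun z : ℝ × ℝ => Ws z.1) 0 :=
      CHolderAt.comp' hγ hγ1 (g := Ws) (f := Prod.fst) (x := (0 : ℝ × ℝ)) hWs
        ((contDiffAt_fst (n := ((k + 2 : ℕ) : WithTop ℕ∞) + 1)).cHolderAt le_rfl hγ1)
    have e2 : CHolderAt (k + 2) γ (fun z : ℝ × ℝ => Wu z.2) 0 :=
      CHolderAt.comp' hγ hγ1 (g := Wu) (f := Prod.snd) (x := (0 : ℝ × ℝ)) hWu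
        ((contDiffAt_snd (n := ((k + 2 : ℕ) : WithTop ℕ∞) + 1)).cHolderAt le_rfl hγ1)
    have e3 : ContDiff ℝ (((k + 2 : ℕ) : WithTop ℕ∞) + 1)
      (fun z : ℝ × ℝ => (z.1 * z.2) • u) := by fun_prop
    exact (e1.add e2).add (e3.contDiffAt.cHolderAt le_rfl hγ1)
  have hWs1 := (cHolderAt_succ_iff.1 hWs).1
  have hderiv : ∀ x, DifferentiableAt ℝ Ws x → HasFDerivAt Ψ
      ((ContinuousLinearMap.fst ℝ ℝ ℝ).smulRight (deriv Ws x) +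
        (ContinuousLinearMap.snd ℝ ℝ ℝ).smulRight ((0, 1) + x • u)) (x, 0) := by
    intro x hx
    have hx' : HasDerivAt Ws (deriv Ws x) (x, (0 : ℝ)).1 := hx.hasDerivAt
    have hy' : HasDerivAt Wu (0, 1) (x, (0 : ℝ)).2 := hWud
    have e1 := hx'.hasFDerivAt.comp (x, (0 : ℝ))
      (hasFDerivAt_fst (𝕜 := ℝ) (E := ℝ) (F := ℝ) (p := (x, 0)))
    have e2 := hy'.hasFDerivAt.comp (x, (0 : ℝ))
      (hasFDerivAt_snd (𝕜 := ℝ) (E := ℝ) (F := ℝ) (p := (x, 0)))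
    have e3 := ((hasFDerivAt_fst (𝕜 := ℝ) (E := ℝ) (F := ℝ) (p := (x, 0))).mul
      hasFDerivAt_snd).smul_const u
    refine ((e1.add e2).add e3).congr_fderiv ?_
    ext <;> simp
  have hΨd : HasFDerivAt Ψ (ContinuousLinearMap.id ℝ (ℝ × ℝ)) 0 := by
    refine (hderiv 0 hWsd.differentiableAt).congr_fderiv ?_
    rw [hWsd.deriv]
    ext <;> simp
  have hΨ2 : CHolderAt 2 θ Ψ 0 := hΨ.two_of_lt_or_eq hθ1 hk
  have hG2 : CHolderAt 2 θ G 0 := hG.two_of_lt_or_eq hθ1 hk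
  have hd2 : ∀ {f : ℝ × ℝ → ℝ × ℝ}, CHolderAt 2 θ f 0 → DifferentiableAt ℝ (fderiv ℝ f) 0 :=
    fun hf => (cHolderAt_succ_iff.1 (cHolderAt_succ_iff.1 hf).2).1.self_of_nhds
  have hΨu : fderiv ℝ (fderiv ℝ Ψ) 0 (1, 0) (0, 1) = u := by
    refine fderiv_fderiv_apply_of_eventually_eq (c := (0, 1)) (hd2 hΨ2) (hWs1.mono fun x hx => ?_)
    rw [(hderiv x hx).fderiv]
    simp
  obtain ⟨Φ, hΦ0, hΦd, hΦ, hΦΨ, hΨΦ⟩ := cHolderAt_localInverse (k := 0) hθ.le hθ1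
    (A := ContinuousLinearEquiv.refl ℝ (ℝ × ℝ)) hΨ2 hΨ0 hΨd
  set N : ℝ × ℝ → ℝ × ℝ := fun z => Φ (G (Ψ z))
  have hGΨ0 : G (Ψ 0) = 0 := by rw [hΨ0, hG0]
  have hN0 : N 0 = 0 := by simp only [N, hGΨ0, hΦ0]
  have hGΨ : CHolderAt 2 θ (fun z => G (Ψ z)) 0 :=
    CHolderAt.comp' hθ.le hθ1 (by rwa [hΨ0]) hΨ2
  have hN : CHolderAt 2 θ N 0 :=
    CHolderAt.comp' hθ.le hθ1 (g := Φ) (f := fun z => G (Ψ z)) (by rwa [hGΨ0]) hGΨ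
  have hNd : HasFDerivAt N (A : ℝ × ℝ →L[ℝ] ℝ × ℝ) 0 := by
    have e1 : HasFDerivAt (fun z => G (Ψ z)) _ 0 :=
      HasFDerivAt.comp (0 : ℝ × ℝ) (g := G) (f := Ψ) (by rwa [hΨ0]) hΨd
    have e2 : HasFDerivAt N _ 0 :=
      HasFDerivAt.comp (0 : ℝ × ℝ) (g := Φ) (f := fun z => G (Ψ z)) (by rwa [hGΨ0]) e1
    exact e2.congr_fderiv (by ext <;> simp)
  have hΨN : ∀ᶠ z in 𝓝 0, Ψ (N z) = G (Ψ z) := by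
    have : Tendsto (fun z => G (Ψ z)) (𝓝 0) (𝓝 0) := by
      simpa [hGΨ0] using hGΨ.continuousAt.tendsto
    exact this.eventually hΨΦ
  have hNx : ∀ᶠ x : ℝ in 𝓝 0, N (x, 0) = (μ * x, 0) := by
    have t1 : Tendsto (fun x : ℝ => Ws (μ * x)) (𝓝 0) (𝓝 0) := by
      have := hWs.continuousAt.tendsto.comp (tendsto_const_mul_nhds_zero μ)
      rwa [hWs0] at this
    have t2 : Tendsto (fun x : ℝ => (μ * x, (0 : ℝ))) (𝓝 0) (𝓝 0) :=
      Continuous.tendsto' (by fun_prop) _ _ (by simp)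
    filter_upwards [hWsH, t1.eventually hGH, t2.eventually hΦΨ] with x h1 h2 h3
    rw [← h3]
    simp only [N, hΨx]
    rw [h1, h2]
  have hNy : ∀ᶠ y : ℝ in 𝓝 0, N (0, y) = (0, μ⁻¹ * y) := by
    have t2 : Tendsto (fun y : ℝ => ((0 : ℝ), μ⁻¹ * y)) (𝓝 0) (𝓝 0) :=
      Continuous.tendsto' (by fun_prop) _ _ (by simp)
    filter_upwards [(tendsto_const_mul_nhds_zero μ⁻¹).eventually hWuG,
      t2.eventually hΦΨ] with y h1 h2
    rw [mul_inv_cancel_left₀ hμ0.ne'] at h1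
    rw [← h2]
    simp only [N, hΨy]
    rw [h1]
  have hN2 : fderiv ℝ (fderiv ℝ N) 0 (1, 0) (0, 1) = 0 := by
    have e1 := fderiv_fderiv_comp (g := Ψ) (f := N) (a := 0) (by rw [hN0]; exact hΨ2.1) hN.1
      (1, 0) (0, 1)
    have e2 := fderiv_fderiv_comp (g := G) (f := Ψ) (a := 0) (by rw [hΨ0]; exact hG2.1) hΨ2.1
      (1, 0) (0, 1)
    have e3 : (fun z => Ψ (N z)) =ᶠ[𝓝 0] fun z => G (Ψ z) := hΨN
    have e4 : A (1, 0) = μ • ((1 : ℝ), (0 : ℝ)) := by simp [A]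
    have e5 : A (0, 1) = μ⁻¹ • ((0 : ℝ), (1 : ℝ)) := by simp [A]
    rw [e3.fderiv.fderiv_eq, e2, hN0, hΨ0, hΨd.fderiv, hNd.fderiv, hA.fderiv, hΨu] at e1
    simp only [ContinuousLinearEquiv.coe_coe, ContinuousLinearMap.id_apply, e4, e5, map_smul,
      smul_apply, hΨu, smul_smul, inv_mul_cancel₀ hμ0.ne',
      one_smul] at e1
    have : q + A u = u + fderiv ℝ (fderiv ℝ N) 0 (1, 0) (0, 1) := e1
    rw [hu] at this
    simpa using this.symm
  set f : ℝ × ℝ → ℝ × ℝ := fun z => N z + (-(A : ℝ × ℝ →L[ℝ] ℝ × ℝ)) z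
  have hf : CHolderAt 2 θ f 0 := hN.add
    (((-(A : ℝ × ℝ →L[ℝ] ℝ × ℝ)).contDiff (n := ((2 : ℕ) : WithTop ℕ∞) + 1)).contDiffAt.cHolderAt
      le_rfl hθ1)
  have hf2 : fderiv ℝ (fderiv ℝ f) 0 (1, 0) (0, 1) = 0 := by
    have : fderiv ℝ f =ᶠ[𝓝 0] fun z => fderiv ℝ N z + -(A : ℝ × ℝ →L[ℝ] ℝ × ℝ) := by
      filter_upwards [(cHolderAt_succ_iff.1 hN).1] with z hz
      exact (hz.hasFDerivAt.add (-(A : ℝ × ℝ →L[ℝ] ℝ × ℝ)).hasFDerivAt).fderiv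
    rw [this.fderiv_eq, fderiv_add_const, hN2]
  obtain ⟨φ, hφ0, hφ, hfφ⟩ := exists_eq_mul_smul_of_vanish_axes hθ hf
    (hNx.mono fun x hx => by simp [f, hx, A]) (hNy.mono fun y hy => by simp [f, hy, A])
  refine ⟨Ψ, φ, hΨ0, hΨd, hΨ, hφ, hφ0.trans hf2, ?_⟩
  filter_upwards [hfφ, hΨN] with z h1 h2
  rw [← h2]
  congr 1
  have h3 : N z = A z + (z.1 * z.2) • φ z := by rw [← h1]; simp [f]
  rw [h3]
  ext <;> simp [A]

end NormalForm

section Conversion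

lemma HolderNear.exists_holderOnWith {E F : Type*} [NormedAddCommGroup E] [NormedAddCommGroup F]
    {γ : ℝ} (hγ : 0 ≤ γ) {f : E → F} {x : E} (h : HolderNear γ f x) :
    ∃ (C : ℝ≥0) (δ : ℝ), 0 < δ ∧ HolderOnWith C (Real.toNNReal γ) f (Metric.ball x δ) := by
  obtain ⟨C, hC, δ, hδ, h⟩ := h.exists_ball
  refine ⟨C.toNNReal, δ, hδ, fun y hy z hz => ?_⟩
  rw [edist_dist, edist_dist, ENNReal.ofReal_rpow_of_nonneg dist_nonneg (by positivity),
    ← ENNReal.ofReal_coe_nnreal, ← ENNReal.ofReal_mul (by positivity)]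
  refine ENNReal.ofReal_le_ofReal ?_
  rw [Real.coe_toNNReal _ hC.le, Real.coe_toNNReal _ hγ, dist_eq_norm, dist_eq_norm]
  exact h y hy z hz

lemma CrFunOn.cHolderAt {E F : Type*} [NormedAddCommGroup E] [NormedSpace ℝ E]
    [NormedAddCommGroup F] [NormedSpace ℝ F] {r : ℝ} (hr : 0 ≤ r) {f : E → F} {s : Set E} {x : E}
    (h : CrFunOn r f s) (hs : s ∈ 𝓝 x) : CHolderAt ⌊r⌋₊ (r - ⌊r⌋₊) f x := by
  obtain ⟨h1, C, hC⟩ := h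
  have hγ : 0 ≤ r - ⌊r⌋₊ := sub_nonneg.2 (Nat.floor_le hr)
  refine ⟨h1.contDiffAt hs, ?_⟩
  have h2 : HolderNear (r - ⌊r⌋₊) (iteratedFDerivWithin ℝ ⌊r⌋₊ f s) x := by
    obtain ⟨δ, hδ, hb⟩ := Metric.mem_nhds_iff.1 hs
    refine HolderNear.of_ball (C := C) hδ fun y hy z hz => ?_
    have := hC.dist_le (hb hy) (hb hz)
    rwa [Real.coe_toNNReal _ hγ, dist_eq_norm, dist_eq_norm] at this
  refine h2.congr ?_
  filter_upwards [eventually_mem_nhds_iff.2 hs] with y hy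
  rw [← iteratedFDerivWithin_univ]
  exact iteratedFDerivWithin_congr_set (by simpa using hy) _

lemma CHolderAt.exists_crFunOn {E F : Type*} [NormedAddCommGroup E] [NormedSpace ℝ E]
    [NormedAddCommGroup F] [NormedSpace ℝ F] {r : ℝ} (hr : 0 ≤ r) {f : E → F} {x : E}
    (h : CHolderAt ⌊r⌋₊ (r - ⌊r⌋₊) f x) :
    ∃ δ > 0, ∀ ε ≤ δ, CrFunOn r f (Metric.ball x ε) := by
  obtain ⟨C, δ₁, hδ₁, hC⟩ := h.2.exists_holderOnWith (sub_nonneg.2 (Nat.floor_le hr))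
  obtain ⟨δ₂, hδ₂, hd⟩ := Metric.eventually_nhds_iff_ball.1 (h.1.eventually (by simp))
  refine ⟨min δ₁ δ₂, by positivity, fun ε hε => ⟨fun y hy => ?_, C, fun y hy z hz => ?_⟩⟩
  · exact (hd y (Metric.ball_subset_ball (hε.trans (min_le_right _ _)) hy)).contDiffWithinAt
  · rw [iteratedFDerivWithin_of_isOpen _ Metric.isOpen_ball hy,
      iteratedFDerivWithin_of_isOpen _ Metric.isOpen_ball hz]
    have hsub := Metric.ball_subset_ball (x := x) (hε.trans (min_le_left _ _))
    exact hC y (hsub hy) z (hsub hz)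

/-- Coordinates adapted to two eigenvectors with distinct eigenvalues `μ` and `μ⁻¹`. -/
lemma exists_diagonalizing_equiv {μ : ℝ} (hμ0 : 0 < μ) (hμ1 : μ < 1) {L : ℝ × ℝ →L[ℝ] ℝ × ℝ}
    {v w : ℝ × ℝ} (hv : v ≠ 0) (hw : w ≠ 0) (hLv : L v = μ • v) (hLw : L w = μ⁻¹ • w) :
    ∃ P : (ℝ × ℝ) ≃L[ℝ] (ℝ × ℝ),
      ∀ z, L (P z) = P (diagEquiv μ μ⁻¹ hμ0.ne' (inv_ne_zero hμ0.ne') z) := by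
  let P₀ : ℝ × ℝ →ₗ[ℝ] ℝ × ℝ :=
    (LinearMap.fst ℝ ℝ ℝ).smulRight v + (LinearMap.snd ℝ ℝ ℝ).smulRight w
  have hP₀ : ∀ z, P₀ z = z.1 • v + z.2 • w := fun z => rfl
  have hμ' : 1 < μ⁻¹ := (one_lt_inv₀ hμ0).2 hμ1
  have hinj : Function.Injective P₀ := by
    rw [← LinearMap.ker_eq_bot, LinearMap.ker_eq_bot']
    intro z hz
    rw [hP₀] at hz
    have h1 := congrArg L hz
    rw [map_add, map_smul, map_smul, hLv, hLw, map_zero] at h1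
    have h2 : ((μ⁻¹ - μ) * z.1) • v = 0 := by
      have : ((μ⁻¹ - μ) * z.1) • v = μ⁻¹ • (z.1 • v + z.2 • w) -
          (z.1 • μ • v + z.2 • μ⁻¹ • w) := by module
      rw [this, hz, h1, smul_zero, sub_zero]
    have h3 : z.1 = 0 := by
      have := (smul_eq_zero.1 h2).resolve_right hv
      exact (mul_eq_zero.1 this).resolve_left (by linarith)
    rw [h3, zero_smul, zero_add] at hz
    exact Prod.ext h3 ((smul_eq_zero.1 hz).resolve_right hw)
  refine ⟨(LinearEquiv.ofInjectiveEndo P₀ hinj).toContinuousLinearEquiv, fun z => ?_⟩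
  have hP : ∀ z, (LinearEquiv.ofInjectiveEndo P₀ hinj).toContinuousLinearEquiv z =
      z.1 • v + z.2 • w := fun z => rfl
  rw [hP, hP, map_add, map_smul, map_smul, hLv, hLw, diagEquiv_apply, smul_smul, smul_smul,
    mul_comm μ, mul_comm μ⁻¹]

end Conversion

/-- Normal form for a `C^{k+2,γ}` germ with a hyperbolic saddle at the origin. -/
lemma exists_normal_form {μ : ℝ} (hμ0 : 0 < μ) (hμ1 : μ < 1) {γ θ : ℝ} (hγ : 0 ≤ γ)
    (hγ1 : γ ≤ 1) (hθ : 0 < θ) (hθ1 : θ ≤ 1) {k : ℕ} (hk : 0 < k ∨ k = 0 ∧ θ = γ)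
    {F : ℝ × ℝ → ℝ × ℝ} (hF : CHolderAt (k + 2) γ F 0) (hF0 : F 0 = 0) {v w : ℝ × ℝ}
    (hv : v ≠ 0) (hw : w ≠ 0) (hFv : fderiv ℝ F 0 v = μ • v) (hFw : fderiv ℝ F 0 w = μ⁻¹ • w) :
    ∃ (P : (ℝ × ℝ) ≃L[ℝ] (ℝ × ℝ)) (Ψ φ : ℝ × ℝ → ℝ × ℝ), Ψ 0 = 0 ∧
      HasFDerivAt Ψ (P : ℝ × ℝ →L[ℝ] ℝ × ℝ) 0 ∧ CHolderAt (k + 2) γ Ψ 0 ∧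
      HolderNear θ φ 0 ∧ φ 0 = 0 ∧ ∀ᶠ z : ℝ × ℝ in 𝓝 0, F (Ψ z) =
        Ψ (μ * z.1 + z.1 * z.2 * (φ z).1, μ⁻¹ * z.2 + z.1 * z.2 * (φ z).2) := by
  obtain ⟨P, hP⟩ := exists_diagonalizing_equiv hμ0 hμ1 hv hw hFv hFw
  have hFd : HasFDerivAt F (fderiv ℝ F 0) 0 :=
    (cHolderAt_succ_iff.1 hF).1.self_of_nhds.hasFDerivAt
  have hFP : CHolderAt (k + 2) γ (fun z => F (P z)) 0 :=
    CHolderAt.comp' hγ hγ1 (g := F) (f := P) (by rwa [map_zero])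
      ((P.contDiff (n := ((k + 2 : ℕ) : WithTop ℕ∞) + 1)).contDiffAt.cHolderAt le_rfl hγ1)
  have hG : CHolderAt (k + 2) γ (fun z => P.symm (F (P z))) 0 :=
    hFP.clm_comp hγ1 (P.symm : ℝ × ℝ →L[ℝ] ℝ × ℝ)
  have hGd : HasFDerivAt (fun z => P.symm (F (P z)))
      (diagEquiv μ μ⁻¹ hμ0.ne' (inv_ne_zero hμ0.ne') : ℝ × ℝ →L[ℝ] ℝ × ℝ) 0 := by
    have e1 : HasFDerivAt (fun z => F (P z)) _ 0 :=
      HasFDerivAt.comp (0 : ℝ × ℝ) (g := F) (f := P) (by rwa [map_zero]) P.hasFDerivAt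
    have e2 := P.symm.hasFDerivAt.comp (0 : ℝ × ℝ) e1
    refine e2.congr_fderiv (ContinuousLinearMap.ext fun z => ?_)
    simp [hP]
  obtain ⟨Ψ, φ, hΨ0, hΨd, hΨ, hφ, hφ0, h⟩ := exists_normal_form_of_diag hμ0 hμ1 hγ hγ1 hθ hθ1 hk
    hG (by simp [hF0]) hGd
  refine ⟨P, fun z => P (Ψ z), φ, by simp [hΨ0], ?_,
    hΨ.clm_comp hγ1 (P : ℝ × ℝ →L[ℝ] ℝ × ℝ), hφ, hφ0, h.mono fun z hz => ?_⟩
  · exact P.hasFDerivAt.comp (0 : ℝ × ℝ) hΨd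
  · simp only [← hz, P.apply_symm_apply]

/-- **Moser normal form in low regularity (Section 2.2).** Let `F` be a `C^r`
(`r > 2`) area preserving, orientation preserving local diffeomorphism of a
neighborhood of the origin in `ℝ²`, for which the origin is a hyperbolic saddle
with eigenvalues `μ, μ⁻¹`, `μ ∈ (0,1)`.  Set `θ = min 1 (r - 2) > 0`.  Then there
is a `C^r` change of coordinates `Ψ` fixing the origin such that
`Ψ⁻¹ ∘ F ∘ Ψ (x,y) = (μx + xy φ₁(x,y), μ⁻¹y + xy φ₂(x,y))` with `φ₁, φ₂`
`θ`-Hölder and vanishing at the origin. -/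
theorem moser_normal_form_low_regularity
    (r : ℝ) (hr : 2 < r) (μ : ℝ) (hμ : μ ∈ Set.Ioo (0:ℝ) 1)
    (U : Set (ℝ × ℝ)) (hU : U ∈ 𝓝 ((0, 0) : ℝ × ℝ))
    (F : ℝ × ℝ → ℝ × ℝ)
    (hFr : CrFunOn r F U)
    (hFinj : Set.InjOn F U)
    (hF0 : F (0, 0) = (0, 0))
    -- area preserving:
    (harea : ∀ s : Set (ℝ × ℝ), MeasurableSet s → s ⊆ U → volume (F '' s) = volume s)
    -- orientation preserving:
    (horient : ∀ z ∈ U, 0 < LinearMap.det (fderivWithin ℝ F U z).toLinearMap)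
    -- hyperbolic saddle with eigenvalues μ, μ⁻¹:
    (hsaddle : ∃ v w : ℝ × ℝ, v ≠ 0 ∧ w ≠ 0 ∧
      fderiv ℝ F (0, 0) v = μ • v ∧ fderiv ℝ F (0, 0) w = μ⁻¹ • w) :
    ∃ (ε : ℝ) (Ψ : ℝ × ℝ → ℝ × ℝ) (φ₁ φ₂ : ℝ × ℝ → ℝ), 0 < ε ∧
      Ψ (0, 0) = (0, 0) ∧
      CrFunOn r Ψ (Metric.ball 0 ε) ∧
      Set.InjOn Ψ (Metric.ball 0 ε) ∧
      (∀ z ∈ Metric.ball (0 : ℝ × ℝ) ε, Ψ z ∈ U) ∧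
      (∀ z ∈ Metric.ball (0 : ℝ × ℝ) ε,
        Function.Bijective (fderivWithin ℝ Ψ (Metric.ball 0 ε) z)) ∧
      (∃ C : ℝ≥0, HolderOnWith C (Real.toNNReal (min 1 (r - 2))) φ₁ (Metric.ball 0 ε) ∧
        HolderOnWith C (Real.toNNReal (min 1 (r - 2))) φ₂ (Metric.ball 0 ε)) ∧
      φ₁ (0, 0) = 0 ∧ φ₂ (0, 0) = 0 ∧
      ∀ z ∈ Metric.ball ((0 : ℝ × ℝ)) ε,
        F (Ψ z) = Ψ (μ * z.1 + z.1 * z.2 * φ₁ z, μ⁻¹ * z.2 + z.1 * z.2 * φ₂ z) := by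
  obtain ⟨v, w, hv, hw, hFv, hFw⟩ := hsaddle
  have hr0 : 0 ≤ r := by linarith
  have hγ : 0 ≤ r - ⌊r⌋₊ := sub_nonneg.2 (Nat.floor_le hr0)
  have hγ1 : r - ⌊r⌋₊ ≤ 1 := by linarith [Nat.lt_floor_add_one r]
  have hθ : 0 < min 1 (r - 2) := lt_min one_pos (by linarith)
  have hn : 2 ≤ ⌊r⌋₊ := Nat.le_floor (by exact_mod_cast hr.le)
  obtain ⟨k, hkn⟩ := Nat.exists_eq_add_of_le' hn
  have hk : 0 < k ∨ k = 0 ∧ min 1 (r - 2) = r - ⌊r⌋₊ := by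
    rcases Nat.eq_zero_or_pos k with rfl | hk
    · refine .inr ⟨rfl, ?_⟩
      rw [hkn] at hγ1 ⊢
      push_cast at hγ1 ⊢
      exact min_eq_right hγ1
    · exact .inl hk
  have hF := hFr.cHolderAt hr0 hU
  obtain ⟨P, Ψ, φ, hΨ0, hΨd, hΨ, hφ, hφ0, heq⟩ := exists_normal_form hμ.1 hμ.2 hγ hγ1 hθ
    (min_le_left _ _) hk (hkn ▸ hF) hF0 hv hw hFv hFw
  have hΨs : HasStrictFDerivAt Ψ (P : ℝ × ℝ →L[ℝ] ℝ × ℝ) 0 := hΨ.1.hasStrictFDerivAt' hΨd (by simp)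
  have hΨU : ∀ᶠ z in 𝓝 0, Ψ z ∈ U := hΨ.continuousAt.eventually_mem (by rwa [hΨ0])
  have hΨe : ∀ᶠ z in 𝓝 0, ∃ e : (ℝ × ℝ) ≃L[ℝ] (ℝ × ℝ),
      (e : ℝ × ℝ →L[ℝ] ℝ × ℝ) = fderiv ℝ Ψ z := by
    have hc : Tendsto (fderiv ℝ Ψ) (𝓝 0) (𝓝 (P : ℝ × ℝ →L[ℝ] ℝ × ℝ)) := by
      simpa [hΨd.fderiv] using (cHolderAt_succ_iff.1 hΨ).2.continuousAt.tendsto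
    exact hc.eventually (ContinuousLinearEquiv.nhds P)
  obtain ⟨δ₁, hδ₁, hball⟩ := Metric.eventually_nhds_iff_ball.1
    (hΨs.eventually_left_inverse.and (hΨU.and (hΨe.and heq)))
  obtain ⟨δ₂, hδ₂, hΨr⟩ := CHolderAt.exists_crFunOn hr0 (f := Ψ) (x := 0) (hkn.symm ▸ hΨ)
  obtain ⟨C, δ₃, hδ₃, hφC⟩ := hφ.exists_holderOnWith hθ.le
  set ε := min δ₁ (min δ₂ δ₃)
  have hε₁ : Metric.ball (0 : ℝ × ℝ) ε ⊆ Metric.ball 0 δ₁ :=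
    Metric.ball_subset_ball (min_le_left _ _)
  have hε₃ : Metric.ball (0 : ℝ × ℝ) ε ⊆ Metric.ball 0 δ₃ :=
    Metric.ball_subset_ball ((min_le_right _ _).trans (min_le_right _ _))
  refine ⟨ε, Ψ, fun z => (φ z).1, fun z => (φ z).2, by positivity, hΨ0,
    hΨr ε ((min_le_right _ _).trans (min_le_left _ _)), fun y hy z hz hyz => ?_,
    fun z hz => (hball z (hε₁ hz)).2.1, fun z hz => ?_,
    ⟨C, fun y hy z hz => ?_, fun y hy z hz => ?_⟩, congrArg Prod.fst hφ0, congrArg Prod.snd hφ0,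
    fun z hz => (hball z (hε₁ hz)).2.2.2⟩
  · rw [← (hball y (hε₁ hy)).1, hyz, (hball z (hε₁ hz)).1]
  · obtain ⟨e, he⟩ := (hball z (hε₁ hz)).2.2.1
    rw [fderivWithin_of_isOpen Metric.isOpen_ball hz, ← he]
    exact e.bijective
  · exact (le_max_left _ _).trans (hφC y (hε₃ hy) z (hε₃ hz))
  · exact (le_max_right _ _).trans (hφC y (hε₃ hy) z (hε₃ hz))

end Paper
end
end

section
/- Let N ≥ 1 and let I be a function from the set {1, …, N+1}^N of N-tuples to pairs (i, ᾱ') such that for every ᾱ ∈ {1, …, N+1}^N, I(ᾱ) = (i, ᾱ[i ↦ 1]) for some index i ∈ {1, …, N} (depending on ᾱ), where ᾱ[i ↦ 1] denotes ᾱ with its i-th coordinate replaced by 1. Then there exist ᾱ, β̄ ∈ {1, …, N+1}^N and i ∈ {1, …, N} such that I(ᾱ) = I(β̄) with first component i, the i-th coordinates satisfy α_i ≠ β_i, and α_j = β_j for all j ≠ i. -/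
namespace Paper

/-- **Combinatorial pigeonhole lemma (Appendix, Lemma A.1).**  Let `N ≥ 1` and let
`I` be a function on `N`-tuples with entries in an `(N+1)`-element set (modelled by
`Fin (N+1)`, with `0` playing the role of the distinguished value "1"), such that
`I ᾱ = (i, ᾱ[i ↦ 1])` for some index `i` depending on `ᾱ`.  Then there exist
tuples `ᾱ, β̄` and an index `i` with `I ᾱ = I β̄ ∈ C_i`, `α_i ≠ β_i`, and
`α_j = β_j` for all `j ≠ i`. -/
theorem pigeonhole_for_tuple_collapsing_maps
    (N : ℕ) (hN : 1 ≤ N)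
    (I : (Fin N → Fin (N + 1)) → Fin N × (Fin N → Fin (N + 1)))
    (hI : ∀ α : Fin N → Fin (N + 1), ∃ i : Fin N, I α = (i, Function.update α i 0)) :
    ∃ (α β : Fin N → Fin (N + 1)) (i : Fin N),
      I α = I β ∧ (I α).1 = i ∧ α i ≠ β i ∧ ∀ j : Fin N, j ≠ i → α j = β j := by
  obtain ⟨n, rfl⟩ : ∃ n, N = n + 1 := ⟨N - 1, by omega⟩
  let f : (Fin (n + 1) → Fin (n + 2)) → Fin (n + 1) × (Fin n → Fin (n + 2)) :=
    fun α => ((I α).1, fun j => α ((I α).1.succAbove j))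
  have hcard : Fintype.card (Fin (n + 1) × (Fin n → Fin (n + 2))) <
      Fintype.card (Fin (n + 1) → Fin (n + 2)) := by
    simp only [Fintype.card_prod, Fintype.card_fun, Fintype.card_fin, pow_succ']
    exact Nat.mul_lt_mul_of_pos_right (Nat.lt_succ_self _) (by positivity)
  obtain ⟨α, β, hne, hf⟩ := Fintype.exists_ne_map_eq_of_card_lt f hcard
  obtain ⟨i, hα⟩ := hI α
  obtain ⟨k, hβ⟩ := hI β
  simp only [f, hα, hβ, Prod.mk.injEq] at hf
  obtain ⟨rfl, hf⟩ := hf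
  have hoff : ∀ j, j ≠ i → α j = β j := by
    intro j hj
    obtain ⟨m, rfl⟩ := Fin.exists_succAbove_eq hj
    exact congrFun hf m
  refine ⟨α, β, i, ?_, by rw [hα], fun h => hne ?_, hoff⟩
  · rw [hα, hβ]
    congr 1
    ext1 j
    by_cases hj : j = i
    · simp [hj]
    · simp [hj, hoff j hj]
  · ext1 j
    by_cases hj : j = i
    · rw [hj, h]
    · exact hoff j hj

end Paper
end
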